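/- arXiv:2102.11422 — 7 statements merged into one kernel-verified Lean document; each statement's English description precedes it below -/
import Mathlib

section
/- A finite matroid M is paving if and only if it is (2,1)-uniform, i.e., if and only if M has no minor isomorphic to U_{2,2} ⊕ U_{0,1} (two coloops together with a loop). -/
open Set

namespace Matroid

variable {α β : Type*}

/-- The rank of a set `X` in a matroid `M` : the maximum cardinality of an
independent subset of `X`. -/
noncomputable def rSet (M : Matroid α) (X : Set α) : ℕ :=
  sSup {n : ℕ | ∃ I, M.Indep I ∧ I ⊆ X ∧ I.ncard = n}

/-- The rank of a matroid. -/
noncomputable def rankM (M : Matroid α) : ℕ := M.rSet M.E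

/-- A circuit of `M` : a minimal dependent subset of the ground set. -/
def CircuitM (M : Matroid α) (C : Set α) : Prop :=
  C ⊆ M.E ∧ ¬ M.Indep C ∧ ∀ D, D ⊂ C → M.Indep D

/-- Deletion of a set from a matroid. -/
def deleteS (M : Matroid α) (D : Set α) : Matroid α := M ↾ (M.E \ D)

/-- Contraction of a set in a matroid. -/
def contractS (M : Matroid α) (C : Set α) : Matroid α := (M✶.deleteS C)✶

/-- `N` is a minor of `M` if it is obtained from `M` by a contraction
followed by a deletion. -/
def IsMinorOf (N M : Matroid α) : Prop :=
  ∃ C D : Set α, C ⊆ M.E ∧ D ⊆ M.E ∧ Disjoint C D ∧ N = (M.contractS C).deleteS D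

/-- `M` is isomorphic to `N` : there is a bijection of the ground sets
preserving independence. -/
def IsoTo (M : Matroid α) (N : Matroid β) : Prop :=
  ∃ e : M.E ≃ N.E, ∀ I : Set M.E,
    M.Indep ((↑) '' I) ↔ N.Indep ((↑) '' (e '' I))

/-- The matroid `U_{k,k} ⊕ U_{0,ℓ}` consisting of `k` coloops and `ℓ` loops. -/
def freeLoopy (k ℓ : ℕ) : Matroid (Fin (k + ℓ)) :=
  uniqueBaseOn {i : Fin (k + ℓ) | (i : ℕ) < k} univ

/-- A matroid is `(k,ℓ)`-uniform if it has no minor isomorphic to `U_{k,k} ⊕ U_{0,ℓ}`. -/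
def KLUniform (k ℓ : ℕ) (M : Matroid α) : Prop :=
  ¬ ∃ N : Matroid α, N.IsMinorOf M ∧ N.IsoTo (freeLoopy k ℓ)

/-- A matroid is paving if every circuit has size at least the rank of the matroid. -/
def PavingM (M : Matroid α) : Prop := ∀ C, M.CircuitM C → M.rankM ≤ C.ncard

/-- A matroid is simple if it has no circuits of size at most two. -/
def SimpleM (M : Matroid α) : Prop := ∀ C, M.CircuitM C → 2 < C.ncard

/-- A matroid is uniform if its independent sets are exactly the subsets of the
ground set of cardinality at most the rank. -/
def UniformM (M : Matroid α) : Prop := ∀ I ⊆ M.E, (M.Indep I ↔ I.ncard ≤ M.rankM)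

/-- A matroid is representable over a field `𝔽` if there is a map from its ground type to
an `𝔽`-vector space under which independence coincides with linear independence. -/
def RepOver (𝔽 : Type*) [Field 𝔽] (M : Matroid α) : Prop :=
  ∃ (W : Type) (_ : AddCommGroup W) (_ : Module 𝔽 W) (φ : α → W),
    ∀ I ⊆ M.E, (M.Indep I ↔ Set.InjOn φ I ∧ LinearIndependent 𝔽 (fun x : I => φ x))


lemma s3_indep_le (M : Matroid α) (hfin : M.Finite) {I : Set α} (hI : M.Indep I) :
    I.ncard ≤ M.rankM := by
  refine le_csSup ⟨M.E.ncard, ?_⟩ ⟨I, hI, hI.subset_ground, rfl⟩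
  rintro n ⟨J, -, hJ, rfl⟩
  exact ncard_le_ncard hJ hfin.ground_finite

lemma s3_rank_eq (M : Matroid α) (hfin : M.Finite) {B : Set α} (hB : M.IsBase B) :
    B.ncard = M.rankM := by
  refine le_antisymm (s3_indep_le M hfin hB.indep) ?_
  refine csSup_le ⟨_, B, hB.indep, hB.subset_ground, rfl⟩ ?_
  rintro n ⟨J, hJ, -, rfl⟩
  obtain ⟨B', hB', hJB'⟩ := hJ.exists_isBase_superset
  rw [hB.ncard_eq_ncard_of_isBase hB']
  exact ncard_le_ncard hJB' (hfin.ground_finite.subset hB'.subset_ground)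

lemma s3_circuit (M : Matroid α) (C : Set α) : M.CircuitM C ↔ M.IsCircuit C := by
  rw [isCircuit_iff_forall_ssubset, CircuitM, Dep]
  tauto

lemma s3_minor (M : Matroid α) (C D : Set α) :
    (M.contractS C).deleteS D = (M.contract C).delete D := rfl

lemma s3_freeLoopy (J : Set (Fin (2 + 1))) : (freeLoopy 2 1).Indep J ↔ (2 : Fin 3) ∉ J := by
  rw [freeLoopy, uniqueBaseOn_indep_iff (subset_univ _)]
  constructor
  · intro h h2
    have := h h2
    simp at this
  · intro h x hx
    have : x ≠ (2 : Fin 3) := fun hh => h (hh ▸ hx)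
    have h2 : (x : ℕ) ≠ 2 := fun hh => this (Fin.ext hh)
    have := x.2
    simp only [mem_setOf_eq]
    omega

lemma s3_iso_of (N : Matroid α) {a b e : α} (hab : a ≠ b) (hae : a ≠ e) (hbe : b ≠ e)
    (hE : N.E = {a, b, e}) (hN : ∀ J ⊆ N.E, N.Indep J ↔ e ∉ J) : N.IsoTo (freeLoopy 2 1) := by
  have ha : a ∈ N.E := by simp [hE]
  have hb : b ∈ N.E := by simp [hE]
  have he : e ∈ N.E := by simp [hE]
  let f : (freeLoopy 2 1).E → N.E := fun i => (![⟨a, ha⟩, ⟨b, hb⟩, ⟨e, he⟩] : Fin 3 → N.E) i.1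
  have hmem : ∀ i : Fin 3, i ∈ (freeLoopy 2 1).E := fun i => mem_univ i
  have hf : Function.Bijective f := by
    constructor
    · rintro ⟨i, hi⟩ ⟨j, hj⟩ h
      have h' : (![⟨a, ha⟩, ⟨b, hb⟩, ⟨e, he⟩] : Fin 3 → N.E) i
        = (![⟨a, ha⟩, ⟨b, hb⟩, ⟨e, he⟩] : Fin 3 → N.E) j := h
      clear h
      apply Subtype.ext
      change Fin 3 at i j
      fin_cases i <;> fin_cases j <;> simp_all [eq_comm]
    · rintro ⟨x, hx⟩
      have hx' := hx
      rw [hE] at hx'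
      rcases hx' with rfl | rfl | rfl
      · exact ⟨⟨(0 : Fin 3), hmem _⟩, rfl⟩
      · exact ⟨⟨(1 : Fin 3), hmem _⟩, rfl⟩
      · exact ⟨⟨(2 : Fin 3), hmem _⟩, rfl⟩
  let g := (Equiv.ofBijective f hf).symm
  have hg : g ⟨e, he⟩ = ⟨(2 : Fin 3), hmem _⟩ := by
    rw [Equiv.symm_apply_eq]
    rfl
  refine ⟨g, fun I => ?_⟩
  rw [hN _ (by rintro _ ⟨x, -, rfl⟩; exact x.2), s3_freeLoopy, not_iff_not]
  constructor
  · rintro ⟨x, hx, rfl⟩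
    exact ⟨_, ⟨x, hx, rfl⟩, by rw [hg]⟩
  · rintro ⟨_, ⟨x, hx, rfl⟩, h⟩
    have : g x = g ⟨e, he⟩ := by rw [hg]; exact Subtype.ext h
    have := g.injective this
    exact ⟨x, hx, by rw [this]⟩

lemma s3_of_iso (N : Matroid α) (h : N.IsoTo (freeLoopy 2 1)) :
    ∃ a b e, a ≠ b ∧ e ∈ N.E ∧ N.Indep {a, b} ∧ ¬ N.Indep {e} := by
  obtain ⟨g, hg⟩ := h
  have hmem : ∀ i : Fin 3, i ∈ (freeLoopy 2 1).E := fun i => mem_univ i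
  have key : ∀ i j : Fin 3, N.Indep {(g.symm ⟨i, hmem i⟩ : α), (g.symm ⟨j, hmem j⟩ : α)} ↔
      (2 : Fin 3) ≠ i ∧ (2 : Fin 3) ≠ j := by
    intro i j
    have := hg {g.symm ⟨i, hmem i⟩, g.symm ⟨j, hmem j⟩}
    rw [s3_freeLoopy] at this
    simp only [image_pair, Equiv.apply_symm_apply] at this
    rw [this, mem_insert_iff, mem_singleton_iff, not_or]
  refine ⟨g.symm ⟨(0 : Fin 3), hmem 0⟩, g.symm ⟨(1 : Fin 3), hmem 1⟩,
    g.symm ⟨(2 : Fin 3), hmem 2⟩, ?_, Subtype.coe_prop _, (key 0 1).2 (by decide), ?_⟩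
  · intro hh
    have := g.symm.injective (Subtype.ext hh)
    have : (0 : Fin 3) = 1 := congrArg Subtype.val this
    exact absurd this (by decide)
  · have := key 2 2
    rw [pair_eq_singleton] at this
    rw [this]
    simp

/-- a finite matroid is paving iff it is `(2,1)`-uniform. -/
theorem stmt3 {α : Type*} (M : Matroid α) (hfin : M.Finite) :
    M.PavingM ↔ M.KLUniform 2 1 := by
  constructor
  · rintro hP ⟨N, ⟨C, D, hC, hD, hCD, rfl⟩, hiso⟩
    obtain ⟨a, b, e, hab, heE, hi, hd⟩ := s3_of_iso _ hiso
    rw [s3_minor] at heE hi hd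
    obtain ⟨I, hI⟩ := M.exists_isBasis C hC
    have heD : e ∉ D := heE.2
    have heC : e ∉ C := heE.1.2
    have heM : e ∈ M.E := heE.1.1
    rw [delete_indep_iff, hI.contract_indep_iff] at hi hd
    have hIfin : I.Finite := hfin.ground_finite.subset hI.indep.subset_ground
    have hdep : M.Dep ({e} ∪ I) := by
      refine ⟨fun h => hd ⟨⟨h, by simpa⟩, by simpa⟩, ?_⟩
      exact union_subset (by simpa) hI.indep.subset_ground
    obtain ⟨K, hK, hKc⟩ := hdep.exists_isCircuit_subset
    have h1 := hP K ((s3_circuit M K).2 hKc)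
    have h2 := s3_indep_le M hfin hi.1.1
    have h3 : K.ncard ≤ I.ncard + 1 := by
      refine (ncard_le_ncard hK ((finite_singleton e).union hIfin)).trans ?_
      rw [singleton_union]
      exact ncard_insert_le _ _
    rw [ncard_union_eq (hi.1.2.symm.mono_right hI.subset) (by simp) hIfin, ncard_pair hab] at h2
    omega
  · intro hU C hC
    by_contra! hlt
    rw [s3_circuit] at hC
    obtain ⟨e, he⟩ := hC.nonempty
    have heM : e ∈ M.E := hC.subset_ground he
    have hI : M.Indep (C \ {e}) := hC.sdiff_singleton_indep he
    have hCfin : C.Finite := hfin.ground_finite.subset hC.subset_ground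
    obtain ⟨I, rfl⟩ : ∃ I, I = C \ {e} := ⟨_, rfl⟩
    obtain ⟨B, hB, hIB⟩ := hI.exists_isBase_superset
    have hBfin : B.Finite := hfin.ground_finite.subset hB.subset_ground
    have hc1 := ncard_sdiff_singleton_add_one he hCfin
    have hc2 := ncard_sdiff_add_ncard_of_subset hIB hBfin
    rw [s3_rank_eq M hfin hB] at hc2
    obtain ⟨a, b, ha, hb, hab⟩ :=
      (one_lt_ncard_iff (hBfin.subset sdiff_subset)).1
        (show 1 < (B \ (C \ {e})).ncard by omega)
    have heB : e ∉ B := by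
      intro heB
      refine hC.not_indep (hB.indep.subset fun x hx => ?_)
      by_cases hxe : x = e
      · exact hxe ▸ heB
      · exact hIB ⟨hx, hxe⟩
    have hae : a ≠ e := fun h => heB (h ▸ ha.1)
    have hbe : b ≠ e := fun h => heB (h ▸ hb.1)
    have haM : a ∈ M.E := hB.subset_ground ha.1
    have hbM : b ∈ M.E := hB.subset_ground hb.1
    have haC : a ∉ C := fun h => ha.2 ⟨h, hae⟩
    have hbC : b ∉ C := fun h => hb.2 ⟨h, hbe⟩
    refine hU ⟨_, ⟨C \ {e}, (M.E \ (C \ {e})) \ {a, b, e}, hI.subset_ground,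
      sdiff_subset.trans sdiff_subset, ?_, rfl⟩, ?_⟩
    · exact disjoint_left.2 fun x hx hx' => hx'.1.2 hx
    · rw [s3_minor]
      have hE : ((M.contract (C \ {e})).delete ((M.E \ (C \ {e})) \ {a, b, e})).E
          = {a, b, e} := by
        rw [delete_ground, contract_ground, sdiff_sdiff_right_self]
        apply inter_eq_right.2
        rintro x (rfl | rfl | rfl)
        · exact ⟨haM, ha.2⟩
        · exact ⟨hbM, hb.2⟩
        · exact ⟨heM, fun h => h.2 rfl⟩
      refine s3_iso_of _ hab hae hbe hE ?_
      intro J hJ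
      have hJ2 := hJ
      rw [delete_ground, contract_ground, subset_sdiff, subset_sdiff] at hJ2
      rw [hE] at hJ
      rw [delete_indep_iff, hI.contract_indep_iff, and_iff_left hJ2.2, and_iff_right hJ2.1.2]
      constructor
      · intro h heJ
        refine hC.not_indep (h.subset fun x hx => ?_)
        by_cases hxe : x = e
        · exact Or.inl (hxe ▸ heJ)
        · exact Or.inr ⟨hx, hxe⟩
      · intro heJ
        refine hB.indep.subset (union_subset ?_ hIB)
        intro x hx
        rcases hJ hx with rfl | rfl | rfl
        · exact ha.1
        · exact hb.1
        · exact absurd hx heJ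

end Matroid
end

section
/- For every integer k ≥ 2 and every prime power q, there exists a constant g(k,q) such that every simple (k,1)-uniform matroid M that is representable over GF(q) and satisfies r*(M) > q (where r*(M) is the rank of the dual M*) has r(M) ≤ g(k,q). -/
open Set

namespace Matroid

variable {α β : Type*}

universe u

theorem rankM_eq_ncard {α : Type*} {M : Matroid α} (hM : M.Finite) {B : Set α}
    (hB : M.IsBase B) : M.rankM = B.ncard := by
  have hE : M.E.Finite := hM.ground_finite
  have hmem : B.ncard ∈ {n : ℕ | ∃ I, M.Indep I ∧ I ⊆ M.E ∧ I.ncard = n} :=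
    ⟨B, hB.indep, hB.subset_ground, rfl⟩
  have hub : ∀ n ∈ {n : ℕ | ∃ I, M.Indep I ∧ I ⊆ M.E ∧ I.ncard = n}, n ≤ B.ncard := by
    rintro n ⟨I, hI, hIE, rfl⟩
    obtain ⟨B', hB', hIB'⟩ := hI.exists_isBase_superset
    rw [hB.ncard_eq_ncard_of_isBase hB']
    exact ncard_le_ncard hIB' (hE.subset hB'.subset_ground)
  exact le_antisymm (csSup_le ⟨_, hmem⟩ hub) (le_csSup ⟨_, hub⟩ hmem)

theorem minor_indep_iff {α : Type*} {M : Matroid α} {J D I : Set α} (hJ : M.Indep J) :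
    ((M.contractS J).deleteS D).Indep I ↔
      (Disjoint I J ∧ M.Indep (I ∪ J)) ∧ I ⊆ (M.E \ J) \ D := by
  have h : (M.contractS J) = M ／ J := rfl
  rw [deleteS, h, restrict_indep_iff, hJ.contract_indep_iff]
  rfl

theorem exists_iso_freeLoopy {α : Type*} {N : Matroid α} {K : Set α} {e : α} {k : ℕ}
    (hKf : K.Finite) (hK : K.ncard = k) (heK : e ∉ K) (hE : N.E = insert e K)
    (hN : ∀ I ⊆ N.E, (N.Indep I ↔ e ∉ I)) : N.IsoTo (freeLoopy k 1) := by
  classical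
  have : Finite K := hKf
  have e0 : K ≃ Fin k := Finite.equivFinOfCardEq hK
  let f : Fin (k + 1) → α := fun i => if h : (i : ℕ) < k then (e0.symm ⟨i, h⟩ : α) else e
  have hfe : ∀ i, f i = e ↔ ¬ (i : ℕ) < k := by
    intro i
    by_cases h : (i : ℕ) < k
    · simp only [f, h, dite_true, not_true, iff_false]
      exact fun h' => heK (h' ▸ (e0.symm ⟨i, h⟩).2)
    · simp [f, h]
  have hinj : Function.Injective f := by
    intro i j hij
    by_cases hi : (i : ℕ) < k
    · by_cases hj : (j : ℕ) < k
      · simp only [f, hi, hj, dite_true] at hij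
        have := e0.symm.injective (Subtype.ext hij)
        simp only [Fin.mk.injEq] at this
        exact Fin.ext this
      · exact absurd hi ((hfe i).1 (hij.trans ((hfe j).2 hj)))
    · have hj : ¬ (j : ℕ) < k := (hfe j).1 (hij.symm.trans ((hfe i).2 hi))
      have := i.2
      have := j.2
      exact Fin.ext (by omega)
  have hrange : range f = N.E := by
    rw [hE]
    ext x
    constructor
    · rintro ⟨i, rfl⟩
      by_cases h : (i : ℕ) < k
      · right
        simp only [f, h, dite_true]
        exact (e0.symm ⟨i, h⟩).2
      · left
        exact (hfe i).2 h
    · rintro (rfl | hx)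
      · exact ⟨⟨k, by omega⟩, (hfe _).2 (by simp)⟩
      · refine ⟨⟨e0 ⟨x, hx⟩, by omega⟩, ?_⟩
        simp [f]
  let g : Fin (k + 1) ≃ N.E := (Equiv.ofInjective f hinj).trans (Equiv.setCongr hrange)
  have hg : ∀ i, (g i : α) = f i := fun i => rfl
  let u : Fin (k + 1) ≃ (freeLoopy k 1).E := (Equiv.Set.univ _).symm
  refine ⟨g.symm.trans u, fun I => ?_⟩
  have hfl : ∀ S, (freeLoopy k 1).Indep S ↔ S ⊆ {i : Fin (k + 1) | (i : ℕ) < k} :=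
    fun S => uniqueBaseOn_indep_iff (subset_univ _)
  rw [hN _ (by simp), hfl]
  constructor
  · rintro h _ ⟨_, ⟨x, hx, rfl⟩, rfl⟩
    show ((g.symm x : Fin (k + 1)) : ℕ) < k
    by_contra hcon
    rw [← hfe, ← hg, Equiv.apply_symm_apply] at hcon
    exact h ⟨x, hx, hcon⟩
  · rintro h ⟨x, hx, hxe⟩
    have h1 : ((g.symm x : Fin (k + 1)) : ℕ) < k := h ⟨_, ⟨x, hx, rfl⟩, rfl⟩
    refine (hfe (g.symm x)).1 ?_ h1
    rw [← hg, Equiv.apply_symm_apply, hxe]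

theorem rank_lt_of_dep {α : Type*} {M : Matroid α} {k : ℕ} (hM : M.Finite)
    (hU : M.KLUniform k 1) {X : Set α} (hX : M.Dep X) : M.rankM < X.ncard + k := by
  classical
  by_contra! hcon
  have hE : M.E.Finite := hM.ground_finite
  obtain ⟨C, hCX, hC⟩ := hX.exists_isCircuit_subset
  obtain ⟨e, he⟩ := hC.nonempty
  have hCE := hC.subset_ground
  have hJ : M.Indep (C \ {e}) := hC.sdiff_singleton_indep he
  obtain ⟨B, hB, hJB⟩ := hJ.exists_isBase_superset
  have hBf : B.Finite := hE.subset hB.subset_ground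
  have heB : e ∉ B := by
    intro h
    refine hC.not_indep (hB.indep.subset ?_)
    intro x hx
    by_cases hxe : x = e
    · exact hxe ▸ h
    · exact hJB ⟨hx, hxe⟩
  have hle : (C \ {e}).ncard ≤ X.ncard :=
    ncard_le_ncard (sdiff_subset.trans hCX) (hE.subset hX.subset_ground)
  have hk : k ≤ (B \ (C \ {e})).ncard := by
    have := ncard_sdiff_add_ncard_of_subset hJB hBf
    rw [rankM_eq_ncard hM hB] at hcon
    omega
  obtain ⟨K, hKB, hK⟩ := exists_subset_card_eq hk
  have hKf : K.Finite := hBf.subset (hKB.trans sdiff_subset)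
  have heK : e ∉ K := fun h => heB (hKB h).1
  have hground : ((M.contractS (C \ {e})).deleteS
      (M.E \ ((C \ {e}) ∪ insert e K))).E = insert e K := by
    show (M.E \ (C \ {e})) \ (M.E \ ((C \ {e}) ∪ insert e K)) = insert e K
    ext x
    have h1 : x ∈ K → x ∈ M.E ∧ ¬ (x ∈ C \ {e}) :=
      fun h => ⟨hB.subset_ground (hKB h).1, (hKB h).2⟩
    have h2 : x = e → x ∈ M.E := fun h => h ▸ hCE he
    simp only [mem_sdiff, mem_union, mem_insert_iff, mem_singleton_iff] at *
    tauto
  refine hU ⟨(M.contractS (C \ {e})).deleteS (M.E \ ((C \ {e}) ∪ insert e K)),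
    ⟨_, _, sdiff_subset.trans hCE, sdiff_subset, ?_, rfl⟩, ?_⟩
  · rw [Set.disjoint_left]
    exact fun x hx hx' => hx'.2 (Or.inl hx)
  · refine exists_iso_freeLoopy hKf hK heK hground fun I hI => ?_
    rw [minor_indep_iff hJ]
    have hI2 := hI
    rw [hground] at hI
    constructor
    · rintro ⟨⟨-, h⟩, -⟩ heI
      refine hC.not_indep (h.subset ?_)
      intro x hx
      by_cases hxe : x = e
      · exact Or.inl (hxe ▸ heI)
      · exact Or.inr ⟨hx, hxe⟩
    · intro heI
      have hIK : I ⊆ K := fun x hx => (hI hx).resolve_left (fun h => heI (h ▸ hx))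
      refine ⟨⟨?_, hB.indep.subset (union_subset (hIK.trans (hKB.trans sdiff_subset)) hJB)⟩, hI2⟩
      rw [Set.disjoint_left]
      exact fun x hx => (hKB (hIK hx)).2

theorem rank_bound {α : Type*} {M : Matroid α} {k : ℕ} (hM : M.Finite)
    {F W : Type*} [Field F] [Fintype F] [AddCommGroup W] [Module F W] (φ : α → W)
    (hφ : ∀ I ⊆ M.E, (M.Indep I ↔ Set.InjOn φ I ∧ LinearIndependent F (fun x : I => φ x)))
    (hdep : ∀ X, M.Dep X → M.rankM < X.ncard + k) (h2 : 2 ≤ M✶.rankM) :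
    M.rankM ≤ k + Fintype.card F * (k + 1) := by
  classical
  have hE : M.E.Finite := hM.ground_finite
  obtain ⟨B, hB⟩ := M.exists_isBase
  have hBf : B.Finite := hE.subset hB.subset_ground
  lift B to Finset α using hBf
  have hMd : M✶.Finite := ⟨hE⟩
  rw [rankM_eq_ncard hMd hB.compl_isBase_dual] at h2
  obtain ⟨e, he, f, hf, hef⟩ := (one_lt_ncard (hE.subset sdiff_subset)).1 h2
  have hdep' : ∀ X ⊆ M.E, ¬ LinearIndepOn F φ X → M.Dep X := by
    intro X hX h
    refine ⟨fun hi => h ((hφ X hX).1 hi).2, hX⟩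
  have hBi : LinearIndepOn F φ (B : Set α) := ((hφ _ hB.subset_ground).1 hB.indep).2
  have hspan : ∀ x ∈ M.E \ (B : Set α), ∃ a : α → F, φ x = ∑ b ∈ B, a b • φ b := by
    intro x hx
    have hmem : φ x ∈ Submodule.span F (φ '' (B : Set α)) := by
      by_contra hcon
      have h1 : LinearIndepOn F φ (insert x (B : Set α)) :=
        (linearIndepOn_insert hx.2).2 ⟨hBi, hcon⟩
      have h3 : M.Indep (insert x (B : Set α)) :=
        (hφ _ (insert_subset hx.1 hB.subset_ground)).2 ⟨h1.injOn, h1⟩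
      exact hx.2 (by
        have := hB.eq_of_subset_indep h3 (subset_insert _ _)
        rw [this]
        exact mem_insert _ _)
    obtain ⟨a, ha⟩ := Submodule.mem_span_image_finset_iff_exists_fun' F |>.1 hmem
    exact ⟨a, ha.symm⟩
  obtain ⟨a, ha⟩ := hspan e he
  obtain ⟨c, hc⟩ := hspan f hf
  have hr : M.rankM = B.card := by rw [rankM_eq_ncard hM hB, ncard_coe_finset]
  -- membership of a linear combination in the span of its support
  have hsum : ∀ (w : α → F) (S : Set α), (∀ b ∈ B, w b ≠ 0 → b ∈ S) →
      ∑ b ∈ B, w b • φ b ∈ Submodule.span F (φ '' S) := by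
    intro w S hS
    refine Submodule.sum_mem _ fun b hb => ?_
    by_cases hw : w b = 0
    · rw [hw, zero_smul]
      exact Submodule.zero_mem _
    · exact Submodule.smul_mem _ _ (Submodule.subset_span ⟨b, hS b hb hw, rfl⟩)
  have hz : (B.filter fun b => a b = 0).card ≤ k := by
    have hd : M.Dep ((insert e (B.filter fun b => ¬ a b = 0) : Finset α) : Set α) := by
      apply hdep'
      · rw [Finset.coe_insert]
        refine insert_subset he.1 (Subset.trans ?_ hB.subset_ground)
        exact_mod_cast Finset.filter_subset _ _
      · intro hli
        refine hli.notMem_span (i := e) (by simp) ?_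
        rw [ha]
        refine hsum a _ fun b hb hab => ?_
        have hbe : b ≠ e := fun h => he.2 (h ▸ hb)
        simp [hb, hab, hbe]
    have h1 := hdep _ hd
    rw [ncard_coe_finset, hr] at h1
    have h3 := Finset.card_insert_le e (B.filter fun b => ¬ a b = 0)
    have h4 := Finset.card_filter_add_card_filter_not (s := B) (fun b => a b = 0)
    omega
  have hl : ∀ l : F, (B.filter fun b => c b = l * a b).card ≤ k + 1 := by
    intro l
    have hd : M.Dep ((insert f (insert e (B.filter fun b => ¬ c b = l * a b)) : Finset α) :
        Set α) := by
      apply hdep'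
      · rw [Finset.coe_insert, Finset.coe_insert]
        refine insert_subset hf.1 (insert_subset he.1 (Subset.trans ?_ hB.subset_ground))
        exact_mod_cast Finset.filter_subset _ _
      · intro hli
        refine hli.notMem_span (i := f) (by simp) ?_
        have hfe : φ f = l • φ e + ∑ b ∈ B, (c b - l * a b) • φ b := by
          rw [hc, ha, Finset.smul_sum, ← Finset.sum_add_distrib]
          refine Finset.sum_congr rfl fun b _ => ?_
          rw [smul_smul, ← add_smul]
          congr 1
          ring
        rw [hfe]
        refine Submodule.add_mem _ (Submodule.smul_mem _ _
          (Submodule.subset_span ⟨e, by simp [hef], rfl⟩)) ?_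
        refine hsum _ _ fun b hb hab => ?_
        have hbf : b ≠ f := fun h => hf.2 (h ▸ hb)
        rw [sub_ne_zero] at hab
        simp [hb, hab, hbf]
    have h1 := hdep _ hd
    rw [ncard_coe_finset, hr] at h1
    have h3 := Finset.card_insert_le e (B.filter fun b => ¬ c b = l * a b)
    have h3' := Finset.card_insert_le f (insert e (B.filter fun b => ¬ c b = l * a b))
    have h4 := Finset.card_filter_add_card_filter_not (s := B) (fun b => c b = l * a b)
    omega
  have hcover : B ⊆ (B.filter fun b => a b = 0) ∪
      (Finset.univ : Finset F).biUnion (fun l => B.filter fun b => c b = l * a b) := by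
    intro b hb
    by_cases hab : a b = 0
    · simp [hb, hab]
    · refine Finset.mem_union_right _ (Finset.mem_biUnion.2 ⟨c b / a b, Finset.mem_univ _, ?_⟩)
      simp [hb, hab]
  rw [hr]
  have h5 := Finset.card_biUnion_le_card_mul (Finset.univ : Finset F)
    (fun l => B.filter fun b => c b = l * a b) (k + 1) (fun l _ => hl l)
  rw [Finset.card_univ] at h5
  exact (Finset.card_le_card hcover).trans ((Finset.card_union_le _ _).trans (add_le_add hz h5))

/-- for `k ≥ 2` and a prime power `q = p ^ c`, there is a bound `g(k,q)` on the
rank of simple `(k,1)`-uniform `GF(q)`-representable matroids of corank greater than `q`. -/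
theorem stmt6 (k p c : ℕ) [Fact p.Prime] (hc : c ≠ 0) (hk : 2 ≤ k) :
    ∃ g : ℕ, ∀ (α : Type u) (M : Matroid α), M.Finite → M.SimpleM →
      M.KLUniform k 1 → Matroid.RepOver (GaloisField p c) M →
      p ^ c < M✶.rankM → M.rankM ≤ g := by
  have : Fintype (GaloisField p c) := Fintype.ofFinite _
  refine ⟨k + Fintype.card (GaloisField p c) * (k + 1), ?_⟩
  rintro α M hM - hU ⟨W, _, _, φ, hφ⟩ hr
  refine rank_bound hM φ hφ (fun X hX => rank_lt_of_dep hM hU hX) ?_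
  have hp : 2 ≤ p := (Fact.out : p.Prime).two_le
  have := Nat.le_self_pow hc p
  omega

end Matroid
end

section
/- For every pair (k,ℓ) of positive integers and every prime power q, there exists a constant f(k,ℓ,q) such that every simple, cosimple, (k,ℓ)-uniform matroid M that is representable over GF(q) satisfies r(M) ≤ f(k,ℓ,q). -/
open Set

namespace Matroid

variable {α β : Type*}

universe u

theorem exists_equal_rows {α : Type*} {K W : Type*} [Field K] [Finite K] [AddCommGroup W] [Module K W]
    (φ : α → W) (M : Matroid α) [M.Finite]
    (hφ : ∀ I ⊆ M.E, (M.Indep I ↔ Set.InjOn φ I ∧ LinearIndependent K (fun x : I => φ x)))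
    (B : Set α) (hB : M.IsBase B) (L : Set α) (hL : L ⊆ M.E \ B) (k m : ℕ)
    (hLm : L.ncard ≤ m) (hk : k * Nat.card K ^ m < B.ncard) :
    ∃ R ⊆ B, R.ncard = k + 1 ∧ ∀ C, M.Indep C → C ⊆ (B \ R) ∪ L → C.ncard + k ≤ B.ncard := by
  classical
  have hBfin : B.Finite := M.ground_finite.subset hB.subset_ground
  have hLfin : L.Finite := M.ground_finite.subset (hL.trans sdiff_subset)
  have hspan : ∀ e ∈ L, φ e ∈ Submodule.span K (φ '' B) := by
    intro e he
    by_contra hcon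
    have hBi := ((hφ B hB.subset_ground).1 hB.indep).2
    have h1 : LinearIndepOn K φ (insert e B) := LinearIndepOn.insert hBi hcon
    have h2 : M.Indep (insert e B) :=
      (hφ _ (insert_subset (hL he).1 hB.subset_ground)).2 ⟨h1.injOn, h1⟩
    have h3 := hB.eq_of_subset_indep h2 (subset_insert e B)
    exact (hL he).2 (h3 ▸ mem_insert e B)
  lift B to Finset α using hBfin
  lift L to Finset α using hLfin
  have hco : ∀ e ∈ L, ∃ a : α → K, ∑ b ∈ B, a b • φ b = φ e := by
    intro e he
    obtain ⟨c, hc⟩ := (Submodule.mem_span_image_finset_iff_exists_fun K).1 (hspan e he)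
    refine ⟨fun b => if h : b ∈ B then c ⟨b, h⟩ else 0, ?_⟩
    rw [← hc, ← Finset.sum_coe_sort B]
    exact Finset.sum_congr rfl fun b _ => by simp
  choose! a ha using hco
  have := Fintype.ofFinite K
  obtain ⟨y, -, hy⟩ := Finset.exists_lt_card_fiber_of_mul_lt_card_of_maps_to
    (s := B) (t := (Finset.univ : Finset (L → K))) (f := fun b (e : L) => a e b) (n := k)
    (fun _ _ => Finset.mem_univ _) (by
      rw [Finset.card_univ, Fintype.card_fun, Fintype.card_coe, ← Nat.card_eq_fintype_card]
      rw [ncard_coe_finset] at hk hLm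
      refine lt_of_le_of_lt ?_ hk
      rw [mul_comm]
      exact Nat.mul_le_mul_left _ (Nat.pow_le_pow_right Nat.card_pos hLm))
  obtain ⟨R, hR, hRc⟩ := Finset.exists_subset_card_eq (Nat.succ_le_of_lt hy)
  have hRB : R ⊆ B := hR.trans (Finset.filter_subset _ _)
  refine ⟨R, by exact_mod_cast hRB, by rw [ncard_coe_finset]; exact hRc, ?_⟩
  intro C hC hCX
  have hCfin : C.Finite := M.ground_finite.subset hC.subset_ground
  lift C to Finset α using hCfin
  have hCi := (hφ _ hC.subset_ground).1 hC
  set S : Finset W := insert (∑ b ∈ R, φ b) ((B \ R).image φ) with hS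
  have hsub : ∀ x ∈ C, φ x ∈ Submodule.span K (S : Set W) := by
    intro x hx
    have hin : ∀ b ∈ B \ R, φ b ∈ Submodule.span K (S : Set W) := fun b hb =>
      Submodule.subset_span (by
        rw [hS]; exact Finset.mem_coe.2 (Finset.mem_insert_of_mem (Finset.mem_image_of_mem _ hb)))
    rcases hCX (Finset.mem_coe.2 hx) with h | h
    · exact hin x (by simpa using h)
    · rw [← ha x h, ← Finset.sum_sdiff hRB]
      refine Submodule.add_mem _ (Submodule.sum_mem _ fun b hb => Submodule.smul_mem _ _ (hin b hb)) ?_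
      have : ∑ b ∈ R, a x b • φ b = y ⟨x, h⟩ • ∑ b ∈ R, φ b := by
        rw [Finset.smul_sum]
        refine Finset.sum_congr rfl fun b hb => ?_
        have := (Finset.mem_filter.1 (hR hb)).2
        rw [← this]
      rw [this]
      exact Submodule.smul_mem _ _ (Submodule.subset_span (by
        rw [hS]; exact Finset.mem_coe.2 (Finset.mem_insert_self _ _)))
  have hcard : C.card ≤ S.card := by
    have h1 := finrank_span_eq_card hCi.2
    have h2 : Submodule.span K (range fun x : (C : Set α) => φ x) ≤ Submodule.span K (S : Set W) := by
      rw [Submodule.span_le]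
      rintro _ ⟨x, rfl⟩
      exact hsub x x.2
    have : FiniteDimensional K (Submodule.span K (S : Set W)) :=
      FiniteDimensional.span_finset K S
    have h3 := Submodule.finrank_mono h2
    have h4 := finrank_span_finset_le_card (R := K) S
    rw [h1] at h3
    simpa using h3.trans h4
  have hSc : S.card ≤ (B \ R).card + 1 :=
    (Finset.card_insert_le _ _).trans (Nat.add_le_add_right Finset.card_image_le _)
  have := Finset.card_sdiff_add_card_eq_card hRB
  rw [ncard_coe_finset, ncard_coe_finset]
  omega

theorem not_klUniform {α : Type*} (M : Matroid α) [M.Finite] (k ℓ : ℕ) (B C L : Set α)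
    (hB : M.IsBase B) (hC : M.Indep C) (hCB : C.ncard + k ≤ B.ncard) (hLC : Disjoint L C)
    (hL : L.ncard = ℓ) (hcl : L ⊆ M.closure C) : ¬ M.KLUniform k ℓ := by
  classical
  intro hkl
  apply hkl
  obtain ⟨B', hB', hCB'⟩ := hC.exists_isBase_superset
  have hB'fin : B'.Finite := M.ground_finite.subset hB'.subset_ground
  have hcard : k ≤ (B' \ C).ncard := by
    have h1 := hB.ncard_eq_ncard_of_isBase hB'
    have h2 := ncard_sdiff_add_ncard_of_subset hCB' hB'fin
    omega
  obtain ⟨A, hA, hAk⟩ := exists_subset_card_eq hcard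
  have hLE : L ⊆ M.E := hcl.trans (M.closure_subset_ground C)
  have hAE : A ⊆ M.E := (hA.trans sdiff_subset).trans hB'.subset_ground
  have hAC : Disjoint A C := disjoint_of_subset_left hA disjoint_sdiff_left
  have hCA : M.Indep (A ∪ C) :=
    hB'.indep.subset (union_subset (hA.trans sdiff_subset) hCB')
  have hnot : ∀ e ∈ L, ¬ M.Indep (insert e C) := by
    intro e he hi
    have := (hC.mem_closure_iff_of_notMem (disjoint_left.1 hLC he)).1 (hcl he)
    exact this.not_indep hi
  have hAL : Disjoint A L := by
    rw [disjoint_left]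
    intro e heA heL
    exact hnot e heL (hCA.subset (insert_subset (Or.inl heA) subset_union_right))
  have hLfin : L.Finite := M.ground_finite.subset hLE
  have hAfin : A.Finite := M.ground_finite.subset hAE
  have hE : ((M.contractS C).deleteS (M.E \ (C ∪ (A ∪ L)))).E = A ∪ L := by
    change (M.E \ C) \ (M.E \ (C ∪ (A ∪ L))) = A ∪ L
    ext x
    have h1 : x ∈ A → x ∉ C := fun h => disjoint_left.1 hAC h
    have h2 : x ∈ L → x ∉ C := fun h => disjoint_left.1 hLC h
    have h3 := @hAE x
    have h4 := @hLE x
    simp only [mem_sdiff, mem_union]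
    tauto
  have hindep : ∀ I ⊆ A ∪ L, ((M.contractS C).deleteS (M.E \ (C ∪ (A ∪ L)))).Indep I ↔ I ⊆ A := by
    intro I hI
    change ((M ／ C) ＼ (M.E \ (C ∪ (A ∪ L)))).Indep I ↔ I ⊆ A
    rw [delete_indep_iff, hC.contract_indep_iff]
    constructor
    · rintro ⟨⟨-, h⟩, -⟩ x hx
      rcases hI hx with h' | h'
      · exact h'
      · exact (hnot x h' (h.subset (insert_subset (Or.inl hx) subset_union_right))).elim
    · intro h
      refine ⟨⟨?_, hCA.subset (union_subset_union_left _ h)⟩, ?_⟩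
      · first
          | exact disjoint_of_subset_left h hAC
          | exact (disjoint_of_subset_left h hAC).symm
      · rw [disjoint_left]
        rintro x hx ⟨-, hx'⟩
        exact hx' (Or.inr (hI hx))
  refine ⟨_, ⟨C, M.E \ (C ∪ (A ∪ L)), hC.subset_ground, sdiff_subset, ?_, rfl⟩, ?_⟩
  · rw [disjoint_left]
    rintro x hx ⟨-, hx'⟩
    exact hx' (Or.inl hx)
  have := hLfin.to_subtype
  have := hAfin.to_subtype
  let e1 : A ≃ Fin k := Finite.equivFinOfCardEq hAk
  let e2 : L ≃ Fin ℓ := Finite.equivFinOfCardEq hL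
  let e0 : (A ∪ L : Set α) ≃ Fin (k + ℓ) :=
    (Equiv.Set.union hAL).trans ((Equiv.sumCongr e1 e2).trans finSumFinEquiv)
  have he0 : ∀ x : (A ∪ L : Set α), (e0 x : ℕ) < k ↔ (x : α) ∈ A := by
    rintro ⟨x, hx⟩
    rcases hx with h | h
    · simp [e0, Equiv.Set.union_apply_left hAL (a := ⟨x, Or.inl h⟩) h, h]
    · have : x ∉ A := disjoint_right.1 hAL h
      simp [e0, Equiv.Set.union_apply_right hAL (a := ⟨x, Or.inr h⟩) h, this]
  let e : ((M.contractS C).deleteS (M.E \ (C ∪ (A ∪ L)))).E ≃ (freeLoopy k ℓ).E :=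
    (Equiv.setCongr hE).trans (e0.trans (Equiv.Set.univ _).symm)
  refine ⟨e, fun I => ?_⟩
  rw [hindep _ (by rintro _ ⟨x, -, rfl⟩; exact hE.subset x.2)]
  refine Iff.trans ?_ (uniqueBaseOn_indep_iff (subset_univ _)).symm
  constructor
  · rintro h _ ⟨_, ⟨x, hx, rfl⟩, rfl⟩
    exact (he0 ⟨x, hE.subset x.2⟩).2 (h ⟨x, hx, rfl⟩)
  · rintro h _ ⟨x, hx, rfl⟩
    exact (he0 ⟨x, hE.subset x.2⟩).1 (h ⟨_, ⟨x, hx, rfl⟩, rfl⟩)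

/-- for positive `k, ℓ` and a prime power `q = p ^ c`, there is a bound
`f(k,ℓ,q)` on the rank of simple cosimple `(k,ℓ)`-uniform `GF(q)`-representable matroids. -/
theorem stmt7 (k ℓ p c : ℕ) [Fact p.Prime] (hc : c ≠ 0) (hk : 0 < k) (hℓ : 0 < ℓ) :
    ∃ f : ℕ, ∀ (α : Type u) (M : Matroid α), M.Finite → M.SimpleM → M✶.SimpleM →
      M.KLUniform k ℓ → Matroid.RepOver (GaloisField p c) M → M.rankM ≤ f := by
  refine ⟨k * Nat.card (GaloisField p c) ^ (ℓ + 1), ?_⟩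
  intro α M hM _ hco hkl ⟨W, _, _, φ, hφ⟩
  refine csSup_le ⟨0, ∅, M.empty_indep, empty_subset _, by simp⟩ ?_
  rintro n ⟨I, hI, -, rfl⟩
  obtain ⟨B, hB, hIB⟩ := hI.exists_isBase_superset
  have hBfin : B.Finite := M.ground_finite.subset hB.subset_ground
  refine (ncard_le_ncard hIB hBfin).trans ?_
  by_contra! hlt
  have hEB : (M.E \ B).Finite := M.ground_finite.subset sdiff_subset
  rcases le_or_gt (ℓ + 1) (M.E \ B).ncard with hm | hm
  · obtain ⟨L, hL, hLc⟩ := exists_subset_card_eq hm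
    obtain ⟨R, hRB, hRc, hR⟩ := exists_equal_rows φ M hφ B hB L hL k (ℓ + 1) hLc.le hlt
    have hXE : (B \ R) ∪ L ⊆ M.E :=
      union_subset (sdiff_subset.trans hB.subset_ground) (hL.trans sdiff_subset)
    have hXfin := M.ground_finite.subset hXE
    obtain ⟨C, hC⟩ := M.exists_isBasis _ hXE
    have hCk := hR C hC.indep hC.subset
    have hX : ((B \ R) ∪ L).ncard = (B \ R).ncard + L.ncard :=
      ncard_union_eq (disjoint_left.2 fun x hx hx' => (hL hx').2 hx.1)
        (hBfin.subset sdiff_subset) (hEB.subset hL)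
    have h1 := ncard_sdiff_add_ncard_of_subset hRB hBfin
    have h2 := ncard_sdiff_add_ncard_of_subset hC.subset hXfin
    obtain ⟨L', hL', hLc'⟩ := exists_subset_card_eq (s := ((B \ R) ∪ L) \ C) (n := ℓ) (by omega)
    exact not_klUniform M k ℓ B C L' hB hC.indep hCk
      (disjoint_of_subset_left hL' disjoint_sdiff_left) hLc'
      ((hL'.trans sdiff_subset).trans hC.subset_closure) hkl
  · obtain ⟨R, hRB, hRc, hR⟩ := exists_equal_rows φ M hφ B hB (M.E \ B) subset_rfl 1 (ℓ + 1) hm.le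
      (lt_of_le_of_lt (Nat.mul_le_mul_right _ hk) hlt)
    have hRE := hRB.trans hB.subset_ground
    have hdep : ¬ M✶.Indep R := by
      intro hi
      rw [dual_indep_iff_exists] at hi
      obtain ⟨B', hB', hd⟩ := hi
      have h1 := hR B' hB'.indep (by
        intro x hx
        by_cases h : x ∈ B
        · exact Or.inl ⟨h, fun h' => disjoint_left.1 hd h' hx⟩
        · exact Or.inr ⟨hB'.subset_ground hx, h⟩)
      have h2 := hB.ncard_eq_ncard_of_isBase hB'
      omega
    have hdep' : M✶.Dep R := ⟨hdep, hRE⟩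
    obtain ⟨D, hDR, hD⟩ := hdep'.exists_isCircuit_subset
    have h1 := hco D ⟨hD.subset_ground, hD.not_indep, fun D' h => hD.ssubset_indep h⟩
    have h2 := ncard_le_ncard hDR (hBfin.subset hRB)
    omega

end Matroid
end

section
/- Let k ≥ 2 and ℓ ≥ 1 be integers, let q be a prime power, and let a and b be natural numbers such that every simple, cosimple, GF(q)-representable (k−1,ℓ+1)-uniform matroid has rank at most a and every simple, cosimple, GF(q)-representable (1,ℓ)-uniform matroid has rank at most b. Then every simple, cosimple, GF(q)-representable (k,ℓ)-uniform matroid has rank at most max{a, b + (k−1)}. -/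
open Set

namespace Matroid

variable {α β : Type*}

/-- Working form of the excluded minor: at least `k` elements that are independent over `I`, and at
least `ℓ` elements spanned by `I`. -/
def Pat (M : Matroid α) (k ℓ : ℕ) : Prop :=
  ∃ I K L : Set α, Disjoint I K ∧ Disjoint I L ∧ Disjoint K L ∧ k ≤ K.ncard ∧ ℓ ≤ L.ncard ∧
    M.Indep (I ∪ K) ∧ L ⊆ M.closure I

theorem freeLoopy_indep_iff {k ℓ : ℕ} {S : Set (Fin (k + ℓ))} :
    (freeLoopy k ℓ).Indep S ↔ ∀ i ∈ S, (i : ℕ) < k := by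
  rw [freeLoopy, uniqueBaseOn_indep_iff (subset_univ _)]
  rfl

theorem pat_of_not_klUniform {M : Matroid α} {k ℓ : ℕ} (h : ¬ M.KLUniform k ℓ) : M.Pat k ℓ := by
  simp only [KLUniform, not_not] at h
  obtain ⟨N, ⟨C, D, hC, hD, hCD, hN⟩, e, he⟩ := h
  have hN' : N = (M.contract C).delete D := hN
  let g : Fin (k + ℓ) → α := fun i => (e.symm ⟨i, mem_univ i⟩).1
  have hg : Function.Injective g := by
    intro i j hij
    have := e.symm.injective (Subtype.val_injective hij)
    exact congrArg Subtype.val this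
  have hgE : ∀ i, g i ∈ N.E := fun i => (e.symm ⟨i, mem_univ i⟩).2
  have hind : ∀ S : Set (Fin (k + ℓ)), N.Indep (g '' S) ↔ ∀ i ∈ S, (i : ℕ) < k := by
    intro S
    have h1 := he (e.symm '' ((↑) ⁻¹' S))
    have h2 : ((↑) '' (e.symm '' ((↑) ⁻¹' S)) : Set α) = g '' S := by
      ext x
      constructor
      · rintro ⟨_, ⟨y, hy, rfl⟩, rfl⟩
        exact ⟨y.1, hy, rfl⟩
      · rintro ⟨y, hy, rfl⟩
        exact ⟨_, ⟨⟨y, mem_univ y⟩, hy, rfl⟩, rfl⟩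
    have h3 : ((↑) '' (e '' (e.symm '' ((↑) ⁻¹' S))) : Set (Fin (k + ℓ))) = S := by
      rw [← image_comp e e.symm]
      simp only [Equiv.self_comp_symm, image_id]
      ext x
      constructor
      · rintro ⟨y, hy, rfl⟩
        exact hy
      · intro hx
        exact ⟨⟨x, mem_univ x⟩, hx, rfl⟩
    rw [h2, h3] at h1
    rw [h1, freeLoopy, uniqueBaseOn_indep_iff (subset_univ _)]
    rfl
  have hNE : ∀ i, g i ∈ M.E ∧ g i ∉ C := by
    intro i
    have := hgE i
    rw [hN'] at this
    exact this.1
  obtain ⟨I, hI⟩ := M.exists_isBasis C hC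
  refine ⟨I, g '' range (Fin.castAdd ℓ), g '' range (Fin.natAdd k), ?_, ?_, ?_, ?_, ?_, ?_, ?_⟩
  · rw [disjoint_left]
    rintro x hx ⟨i, -, rfl⟩
    exact (hNE i).2 (hI.subset hx)
  · rw [disjoint_left]
    rintro x hx ⟨i, -, rfl⟩
    exact (hNE i).2 (hI.subset hx)
  · rw [disjoint_image_iff hg, disjoint_left]
    rintro _ ⟨i, rfl⟩ ⟨j, hj⟩
    have := congrArg Fin.val hj
    simp at this
    omega
  · rw [ncard_image_of_injective _ hg, ← image_univ,
      ncard_image_of_injective _ (Fin.castAdd_injective k ℓ)]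
    simp [ncard_univ]
  · rw [ncard_image_of_injective _ hg, ← image_univ,
      ncard_image_of_injective _ (Fin.natAdd_injective ℓ k)]
    simp [ncard_univ]
  · have h1 : N.Indep (g '' range (Fin.castAdd ℓ)) := by
      rw [hind]
      rintro _ ⟨i, rfl⟩
      simp
    rw [hN', delete_indep_iff, hI.contract_indep_iff] at h1
    rw [union_comm]
    exact h1.1.1
  · rintro _ ⟨_, ⟨i, rfl⟩, rfl⟩
    rw [hI.closure_eq_closure]
    by_contra hcon
    have h1 : (M.contract C).IsNonloop (g (Fin.natAdd k i)) :=
      contract_isNonloop_iff.2 ⟨(hNE _).1, hcon⟩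
    have h2 : N.Indep (g '' {Fin.natAdd k i}) := by
      rw [image_singleton, hN', delete_indep_iff, indep_singleton]
      refine ⟨h1, ?_⟩
      have := hgE (Fin.natAdd k i)
      rw [hN'] at this
      rw [disjoint_singleton_left]
      exact this.2
    rw [hind] at h2
    have := h2 _ rfl
    simp at this

theorem exists_param {K : Set α} {k : ℕ} (hK : K.ncard = k) (hfin : K.Finite) :
    ∃ f : Fin k → α, Function.Injective f ∧ range f = K := by
  have := hfin.to_subtype
  have e : Fin k ≃ K := (Finite.equivFinOfCardEq (by rw [← hK]; rfl)).symm
  exact ⟨fun i => (e i).1, fun i j h => e.injective (Subtype.val_injective h), by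
    ext x
    constructor
    · rintro ⟨i, rfl⟩
      exact (e i).2
    · intro hx
      exact ⟨e.symm ⟨x, hx⟩, by simp⟩⟩

theorem Pat.not_klUniform {M : Matroid α} (hM : M.Finite) {k ℓ : ℕ} (h : M.Pat k ℓ) :
    ¬ M.KLUniform k ℓ := by
  obtain ⟨I, K', L', hIK', hIL', hKL', hk, hl, hind', hcl'⟩ := h
  obtain ⟨K, hKK, hKc⟩ := exists_subset_card_eq hk
  obtain ⟨L, hLL, hLc⟩ := exists_subset_card_eq hl
  have hIK : Disjoint I K := hIK'.mono_right hKK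
  have hIL : Disjoint I L := hIL'.mono_right hLL
  have hKL : Disjoint K L := hKL'.mono hKK hLL
  have hind : M.Indep (I ∪ K) := hind'.subset (union_subset_union_right _ hKK)
  have hcl : L ⊆ M.closure I := hLL.trans hcl'
  have hKE : K ⊆ M.E := subset_union_right.trans hind.subset_ground
  have hLE : L ⊆ M.E := hcl.trans (M.closure_subset_ground I)
  have hI : M.Indep I := hind.subset subset_union_left
  obtain ⟨f, hf, rfl⟩ := exists_param hKc (hM.ground_finite.subset hKE)
  obtain ⟨f', hf', rfl⟩ := exists_param hLc (hM.ground_finite.subset hLE)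
  let g : Fin (k + ℓ) → α := Fin.append f f'
  have hg : Function.Injective g := by
    rw [Fin.append_injective_iff]
    refine ⟨hf, hf', fun i j hij => ?_⟩
    exact disjoint_left.1 hKL ⟨i, rfl⟩ ⟨j, hij.symm⟩
  have hgr : range g = range f ∪ range f' := by
    ext x
    constructor
    · rintro ⟨i, rfl⟩
      refine Fin.addCases (fun i => ?_) (fun i => ?_) i
      · left; simp [g]
      · right; simp [g]
    · rintro (⟨i, rfl⟩ | ⟨i, rfl⟩)
      · exact ⟨Fin.castAdd ℓ i, by simp [g]⟩
      · exact ⟨Fin.natAdd k i, by simp [g]⟩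
  let N : Matroid α := (M.contract I).delete (M.E \ (I ∪ range g))
  have hNE : N.E = range g := by
    have : N.E = (M.E \ I) \ (M.E \ (I ∪ range g)) := rfl
    rw [this]
    have h1 : range g ⊆ M.E := by rw [hgr]; exact union_subset hKE hLE
    have h2 : Disjoint I (range g) := by rw [hgr]; exact disjoint_union_right.2 ⟨hIK, hIL⟩
    ext x
    simp only [mem_sdiff, mem_union]
    constructor
    · rintro ⟨⟨h3, h4⟩, h5⟩
      by_contra h6
      exact h5 ⟨h3, by tauto⟩
    · intro hx
      exact ⟨⟨h1 hx, fun h => disjoint_left.1 h2 h hx⟩, fun h => h.2 (Or.inr hx)⟩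
  have hNind : ∀ S : Set (Fin (k + ℓ)), N.Indep (g '' S) ↔ ∀ i ∈ S, (i : ℕ) < k := by
    intro S
    constructor
    · intro h i hi
      by_contra hlt
      have h1 : N.Indep {g i} := h.subset (by simpa using ⟨i, hi, rfl⟩)
      have h2 := (delete_indep_iff.1 h1).1
      rw [indep_singleton, contract_isNonloop_iff] at h2
      apply h2.2
      apply hcl
      revert hlt
      refine Fin.addCases (fun i => ?_) (fun i => ?_) i
      · intro h; simp at h
      · intro _; simp [g]
    · intro h
      have hsub : g '' S ⊆ range f := by
        rintro _ ⟨i, hi, rfl⟩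
        have := h i hi
        revert this
        refine Fin.addCases (fun i => ?_) (fun i => ?_) i
        · intro _; simp [g]
        · intro h; simp at h
      refine delete_indep_iff.2 ⟨?_, ?_⟩
      · rw [hI.contract_indep_iff]
        refine ⟨(hIK.mono_right hsub).symm, hind.subset ?_⟩
        rw [union_comm]
        exact union_subset_union_right _ hsub
      · rw [disjoint_left]
        rintro _ ⟨i, -, rfl⟩ h
        exact h.2 (Or.inr ⟨i, rfl⟩)
  rw [KLUniform, not_not]
  refine ⟨N, ⟨I, M.E \ (I ∪ range g), hI.subset_ground, sdiff_subset, ?_, rfl⟩, ?_⟩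
  · rw [disjoint_left]
    intro x hx h
    exact h.2 (Or.inl hx)
  let e0 : (freeLoopy k ℓ).E → N.E := fun i => ⟨g i.1, by rw [hNE]; exact ⟨_, rfl⟩⟩
  have he0 : Function.Bijective e0 := by
    constructor
    · intro i j hij
      exact Subtype.val_injective (hg (congrArg Subtype.val hij))
    · rintro ⟨x, hx⟩
      have hx' := hx
      rw [hNE] at hx'
      obtain ⟨i, rfl⟩ := hx'
      exact ⟨⟨i, mem_univ i⟩, rfl⟩
  let e := Equiv.ofBijective e0 he0
  refine ⟨e.symm, fun J => ?_⟩
  have h1 : ((↑) '' J : Set α) = g '' ((↑) '' (e.symm '' J)) := by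
    rw [← image_comp, ← image_comp]
    apply image_congr
    intro x _
    have : (e (e.symm x)).1 = x.1 := by rw [Equiv.apply_symm_apply]
    exact this.symm
  rw [h1, hNind, freeLoopy_indep_iff]

theorem IsBase.rankM_eq {M : Matroid α} (hM : M.Finite) {B : Set α} (hB : M.IsBase B) :
    M.rankM = B.ncard := by
  rw [rankM, rSet]
  apply IsGreatest.csSup_eq
  refine ⟨⟨B, hB.indep, hB.subset_ground, rfl⟩, ?_⟩
  rintro n ⟨I, hI, -, rfl⟩
  obtain ⟨B', hB', hIB'⟩ := hI.exists_isBase_superset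
  rw [hB.ncard_eq_ncard_of_isBase hB']
  exact ncard_le_ncard hIB' (hM.ground_finite.subset hB'.subset_ground)

theorem SimpleM.restrict {M : Matroid α} (h : M.SimpleM) {X : Set α} (hX : X ⊆ M.E) :
    (M ↾ X).SimpleM := by
  rintro C ⟨hC, hd, hmin⟩
  refine h C ⟨hC.trans hX, fun hi => hd (restrict_indep_iff.2 ⟨hi, hC⟩), fun D hD => ?_⟩
  exact (restrict_indep_iff.1 (hmin D hD)).1

theorem RepOver.restrict {𝔽 : Type*} [Field 𝔽] {M : Matroid α} (h : M.RepOver 𝔽) {X : Set α}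
    (hX : X ⊆ M.E) : (M ↾ X).RepOver 𝔽 := by
  obtain ⟨W, i1, i2, φ, hφ⟩ := h
  refine ⟨W, i1, i2, φ, fun I (hI : I ⊆ X) => ?_⟩
  rw [restrict_indep_iff, and_iff_left hI]
  exact hφ I (hI.trans hX)

/-- A matroid of nullity at least `ℓ + 1` without the pattern `(1, ℓ)` is cosimple. -/
theorem cosimple_of_not_pat {N : Matroid α} (hN : N.Finite) {ℓ : ℕ} {B : Set α} (hB : N.IsBase B)
    (hcard : B.ncard + (ℓ + 1) ≤ N.E.ncard) (h : ¬ N.Pat 1 ℓ) : N✶.SimpleM := by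
  rintro C ⟨hC, hd, -⟩
  by_contra hlt
  apply h
  have hC' : C ⊆ N.E := hC
  have hfin : N.E.Finite := hN.ground_finite
  obtain ⟨I, hI⟩ := N.exists_isBasis (N.E \ C) sdiff_subset
  obtain ⟨B', hB', hIB⟩ := hI.indep.exists_isBase_superset
  have hne : ¬ B' ⊆ I := by
    intro hsub
    apply hd
    exact (coindep_iff_exists hC').2 ⟨B', hB', hsub.trans hI.subset⟩
  obtain ⟨x, hxB, hxI⟩ := not_subset.1 hne
  have hfinB : B'.Finite := hfin.subset hB'.subset_ground
  have hlt' : I.ncard < B'.ncard := ncard_lt_ncard ⟨hIB, hne⟩ hfinB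
  rw [hB'.ncard_eq_ncard_of_isBase hB] at hlt'
  have hins : N.Indep (I ∪ {x}) :=
    hB'.indep.subset (union_subset hIB (singleton_subset_iff.2 hxB))
  refine ⟨I, {x}, (N.E \ C) \ I, by simpa, disjoint_sdiff_right, ?_, by simp, ?_, hins, ?_⟩
  · rw [disjoint_singleton_left]
    intro hx
    have h1 : x ∈ N.closure I := by
      rw [hI.closure_eq_closure]
      exact N.mem_closure_of_mem hx.1 sdiff_subset
    have h2 := (hI.indep.mem_closure_iff_of_notMem hxI).1 h1
    rw [union_singleton] at hins
    exact h2.not_indep hins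
  · have h1 := ncard_sdiff_add_ncard_of_subset hC' hfin
    have h2 := ncard_sdiff_add_ncard_of_subset hI.subset (hfin.subset sdiff_subset)
    omega
  · exact sdiff_subset.trans hI.subset_closure

/-- Extending a pattern of a spanned restriction by the elements independent over it. -/
theorem pat_extend {M : Matroid α} (hM : M.Finite) {X I K : Set α} {m ℓ : ℕ}
    (hI : M.IsBasis I X) (hK : M.Indep (I ∪ K)) (hXK : Disjoint X K) (hm : m ≤ K.ncard)
    (h : (M ↾ X).Pat 1 ℓ) : M.Pat (m + 1) ℓ := by
  obtain ⟨I', K', L', hIK', hIL', hKL', hk, hl, hind, hcl⟩ := h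
  rw [restrict_indep_iff] at hind
  obtain ⟨hind, hsub⟩ := hind
  have hXE : X ⊆ M.E := hI.subset_ground
  have hI'X : I' ⊆ X := subset_union_left.trans hsub
  have hK'X : K' ⊆ X := subset_union_right.trans hsub
  rw [restrict_closure_eq _ hI'X hXE] at hcl
  obtain ⟨J, hJ, hIJ⟩ := hind.subset_isBasis_of_subset hsub hXE
  have h1 : (M.contract X).Indep K := by
    rw [hI.contract_indep_iff, union_comm]
    exact ⟨hK, hXK⟩
  rw [hJ.contract_indep_iff] at h1
  have hfin : ∀ {S : Set α}, S ⊆ M.E → S.Finite := fun h => hM.ground_finite.subset h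
  have hKE : K ⊆ M.E := subset_union_right.trans hK.subset_ground
  refine ⟨I', K' ∪ K, L', ?_, hIL', ?_, ?_, hl, h1.1.subset ?_, hcl.trans inter_subset_left⟩
  · exact disjoint_union_right.2 ⟨hIK', hXK.mono_left hI'X⟩
  · exact disjoint_union_left.2 ⟨hKL', (hXK.mono_left (hcl.trans inter_subset_right)).symm⟩
  · rw [ncard_union_eq (hXK.mono_left hK'X) (hfin (hK'X.trans hXE)) (hfin hKE)]
    omega
  · rw [← union_assoc, union_comm]
    exact union_subset_union_right _ hIJ

universe u

/-- the recursive bound `f(k,ℓ,q) ≤ max (f(k-1,ℓ+1,q)) (f(1,ℓ,q) + (k-1))`. -/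
theorem stmt8 (k ℓ p c : ℕ) [Fact p.Prime] (hc : c ≠ 0) (hk : 2 ≤ k) (hℓ : 1 ≤ ℓ)
    (a b : ℕ)
    (ha : ∀ (α : Type u) (M : Matroid α), M.Finite → M.SimpleM → M✶.SimpleM →
      Matroid.RepOver (GaloisField p c) M → M.KLUniform (k - 1) (ℓ + 1) → M.rankM ≤ a)
    (hb : ∀ (α : Type u) (M : Matroid α), M.Finite → M.SimpleM → M✶.SimpleM →
      Matroid.RepOver (GaloisField p c) M → M.KLUniform 1 ℓ → M.rankM ≤ b) :
    ∀ (α : Type u) (M : Matroid α), M.Finite → M.SimpleM → M✶.SimpleM →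
      Matroid.RepOver (GaloisField p c) M → M.KLUniform k ℓ →
      M.rankM ≤ max a (b + (k - 1)) := by
  intro α M hM hs hcs hrep hu
  by_cases hau : M.KLUniform (k - 1) (ℓ + 1)
  · exact (ha α M hM hs hcs hrep hau).trans (le_max_left _ _)
  refine le_trans ?_ (le_max_right _ _)
  have hnp : ¬ M.Pat k ℓ := fun h => h.not_klUniform hM hu
  obtain ⟨I, K, L, hIK, hIL, hKL, hk', hl', hind, hcl⟩ := pat_of_not_klUniform hau
  have hfin : ∀ {S : Set α}, S ⊆ M.E → S.Finite := fun h => hM.ground_finite.subset h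
  have hIi : M.Indep I := hind.subset subset_union_left
  have hLE : L ⊆ M.E := hcl.trans (M.closure_subset_ground I)
  have hKE : K ⊆ M.E := subset_union_right.trans hind.subset_ground
  have hXE : I ∪ L ⊆ M.E := union_subset hIi.subset_ground hLE
  have hbasis : M.IsBasis I (I ∪ L) :=
    hIi.isBasis_of_subset_of_subset_closure subset_union_left
      (union_subset (M.subset_closure I hIi.subset_ground) hcl)
  obtain ⟨B, hB, hIB⟩ := hind.exists_isBase_superset
  have hBI : (B \ I).ncard ≤ k - 1 := by
    by_contra hlt
    apply hnp
    refine ⟨I, B \ I, L, disjoint_sdiff_right, hIL, ?_, by omega, by omega, ?_, hcl⟩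
    · rw [disjoint_left]
      intro x hx hxL
      have h2 := (hIi.mem_closure_iff_of_notMem hx.2).1 (hcl hxL)
      refine h2.not_indep (hB.indep.subset (insert_subset hx.1 ?_))
      exact subset_union_left.trans hIB
    · exact hB.indep.subset (union_subset (subset_union_left.trans hIB) sdiff_subset)
  have hcardB := ncard_sdiff_add_ncard_of_subset (subset_union_left.trans hIB)
    (hfin hB.subset_ground)
  have hNfin : (M ↾ (I ∪ L)).Finite := ⟨hfin hXE⟩
  have hNbase : (M ↾ (I ∪ L)).IsBase I := (isBase_restrict_iff hXE).2 hbasis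
  have hNpat : ¬ (M ↾ (I ∪ L)).Pat 1 ℓ := by
    intro h
    have := pat_extend hM hbasis hind (disjoint_union_left.2 ⟨hIK, hKL.symm⟩) hk' h
    rw [show k - 1 + 1 = k by omega] at this
    exact hnp this
  have hco : (M ↾ (I ∪ L))✶.SimpleM := by
    refine cosimple_of_not_pat hNfin hNbase ?_ hNpat
    rw [restrict_ground_eq, ncard_union_eq hIL (hfin hIi.subset_ground) (hfin hLE)]
    omega
  have hNu : (M ↾ (I ∪ L)).KLUniform 1 ℓ := by
    by_contra h
    exact hNpat (pat_of_not_klUniform h)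
  have hr := hb α _ hNfin (hs.restrict hXE) hco (hrep.restrict hXE) hNu
  rw [hNbase.rankM_eq hNfin] at hr
  rw [hB.rankM_eq hM]
  omega

end Matroid
end

section
/- For every pair (k,ℓ) of positive integers and every prime power q, there exists a natural number n such that every simple, cosimple, (k,ℓ)-uniform matroid that is representable over GF(q) has at most n elements in its ground set (so, up to isomorphism, only finitely many such matroids exist). -/
open Set

namespace Matroid

variable {α β : Type*}

/-- Independent sets in a represented matroid are bounded by the dimension of a containing
subspace. -/
lemma aux_rows {F W : Type*} [Field F] [AddCommGroup W] [Module F W] [DecidableEq α]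
    (φ : α → W) (B S T I : Finset α) (A : α → α → F)
    (hA : ∀ e ∈ T, φ e = ∑ b ∈ B, A e b • φ b) (hS : S ⊆ B) (hSne : S.Nonempty)
    (hrow : ∀ e ∈ T, ∀ s ∈ S, ∀ s' ∈ S, A e s = A e s')
    (hI : LinearIndepOn F φ (I : Set α)) (hIs : I ⊆ (B \ S) ∪ T) :
    I.card + S.card ≤ B.card + 1 := by
  classical
  obtain ⟨s₀, hs₀⟩ := hSne
  set G : Finset W := insert (∑ s ∈ S, φ s) ((B \ S).image φ) with hG
  have hcard : G.card ≤ (B.card - S.card) + 1 := by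
    refine (Finset.card_insert_le _ _).trans ?_
    have := Finset.card_image_le (s := B \ S) (f := φ)
    rw [Finset.card_sdiff_of_subset hS] at this
    omega
  have hB : ∀ b ∈ B \ S, φ b ∈ Submodule.span F (G : Set W) := fun b hb =>
    Submodule.subset_span (by
      rw [hG]; push_cast
      exact Or.inr ⟨b, by simpa using hb, rfl⟩)
  have hmem : ∀ x ∈ I, φ x ∈ Submodule.span F (G : Set W) := by
    intro x hx
    rcases Finset.mem_union.1 (hIs hx) with h | h
    · exact hB x h
    · rw [hA x h, ← Finset.sum_sdiff hS]
      refine Submodule.add_mem _ (Submodule.sum_mem _ fun b hb =>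
        Submodule.smul_mem _ _ (hB b hb)) ?_
      have : ∑ s ∈ S, A x s • φ s = A x s₀ • ∑ s ∈ S, φ s := by
        rw [Finset.smul_sum]
        exact Finset.sum_congr rfl fun s hs => by rw [hrow x h s hs s₀ hs₀]
      rw [this]
      exact Submodule.smul_mem _ _ (Submodule.subset_span (by rw [hG]; simp))
  have hli : LinearIndependent F
      (fun x : (I : Set α) => (⟨φ x, hmem x x.2⟩ : Submodule.span F (G : Set W))) := by
    apply LinearIndependent.of_comp (Submodule.span F (G : Set W)).subtype
    exact hI
  haveI : FiniteDimensional F (Submodule.span F (G : Set W)) :=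
    FiniteDimensional.span_finset F G
  have h1 := hli.fintype_card_le_finrank
  have h2 := finrank_span_finset_le_card (R := F) G
  have h3 : Fintype.card (I : Set α) = I.card := by simp
  have := Finset.card_le_card hS
  simp only [Set.finrank] at h2
  omega

lemma aux_iso {M : Matroid α} {k ℓ : ℕ} {C A L : Finset α}
    (hCA : M.Indep (C ∪ A : Set α)) (hdCA : Disjoint C A) (hdCL : Disjoint C L)
    (hdAL : Disjoint A L)
    (hk : A.card = k) (hl : L.card = ℓ)
    (hL : ∀ x ∈ L, x ∈ M.E ∧ ¬ M.Indep (insert x (C : Set α))) :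
    ¬ M.KLUniform k ℓ := by
  classical
  intro h
  apply h
  have hC : M.Indep (C : Set α) := hCA.subset subset_union_left
  have hCE := hCA.subset_ground
  have hLE : (L : Set α) ⊆ M.E := fun x hx => (hL x hx).1
  have hdAL' : Disjoint (A : Set α) (L : Set α) := by exact_mod_cast hdAL
  have hdCA' : Disjoint (C : Set α) (A : Set α) := by exact_mod_cast hdCA
  have hdCL' : Disjoint (C : Set α) (L : Set α) := by exact_mod_cast hdCL
  set D : Set α := M.E \ (C ∪ (A ∪ L)) with hD
  refine ⟨(M.contractS C).deleteS D, ⟨C, D, subset_union_left.trans hCE, diff_subset,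
    ?_, rfl⟩, ?_⟩
  · rw [hD]; exact disjoint_sdiff_right.mono_left subset_union_left
  have hEq : (M.contractS C).deleteS D = (M ／ (C : Set α)) ＼ D := rfl
  rw [hEq]
  have hE : ((M ／ (C : Set α)) ＼ D).E = (A ∪ L : Set α) := by
    rw [delete_ground, contract_ground, hD]
    ext x
    have h1 : x ∈ (C : Set α) → x ∉ (A : Set α) := fun h h' => hdCA'.le_bot ⟨h, h'⟩
    have h2 : x ∈ (C : Set α) → x ∉ (L : Set α) := fun h h' => hdCL'.le_bot ⟨h, h'⟩
    have h3 : x ∈ (A : Set α) → x ∈ M.E := fun h => hCE (Or.inr h)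
    have h4 : x ∈ (L : Set α) → x ∈ M.E := fun h => hLE h
    simp only [Set.mem_diff, Set.mem_union]
    tauto
  have hind : ∀ J ⊆ (A ∪ L : Set α), ((M ／ (C : Set α)) ＼ D).Indep J ↔ J ⊆ (A : Set α) := by
    intro J hJ
    rw [delete_indep_iff, hC.contract_indep_iff]
    constructor
    · rintro ⟨⟨-, h2⟩, -⟩ x hx
      rcases hJ hx with h | h
      · exact h
      · exact absurd (h2.subset (insert_subset (Or.inl hx) subset_union_right)) (hL x h).2
    · intro hJA
      refine ⟨⟨(hdCA'.mono_right hJA).symm, hCA.subset ?_⟩, ?_⟩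
      · exact union_subset (hJA.trans subset_union_right) subset_union_left
      · rw [hD]; exact disjoint_sdiff_right.mono_left (hJ.trans subset_union_right)
  let eA : (A : Set α) ≃ Fin k := A.equivFinOfCardEq hk
  let eL : (L : Set α) ≃ Fin ℓ := L.equivFinOfCardEq hl
  let e0 : (A ∪ L : Set α) ≃ Fin (k + ℓ) :=
    (Equiv.Set.union hdAL').trans ((Equiv.sumCongr eA eL).trans finSumFinEquiv)
  let e : ((M ／ (C : Set α)) ＼ D).E ≃ (freeLoopy k ℓ).E :=
    (Equiv.setCongr hE).trans (e0.trans (Equiv.Set.univ _).symm)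
  have he : ∀ x, (((e x : Fin (k + ℓ)) : ℕ) < k ↔ (x : α) ∈ A) := by
    rintro ⟨x, hx⟩
    have hx' := hx
    rw [hE] at hx'
    change ((e0 ⟨x, hx'⟩ : Fin (k + ℓ)) : ℕ) < k ↔ x ∈ A
    by_cases hxA : x ∈ (A : Set α)
    · simp only [e0, Equiv.trans_apply]
      rw [Equiv.Set.union_apply_left hdAL' (a := ⟨x, hx'⟩) hxA]
      have : x ∈ A := hxA
      simp [this]
    · have hxL : x ∈ (L : Set α) := hx'.resolve_left hxA
      simp only [e0, Equiv.trans_apply]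
      rw [Equiv.Set.union_apply_right hdAL' (a := ⟨x, hx'⟩) hxL]
      have : x ∉ A := hxA
      simp [this]
  refine ⟨e, fun I => ?_⟩
  rw [hind _ (by rw [← hE]; rintro _ ⟨y, -, rfl⟩; exact y.2)]
  have hfl : ∀ J, (freeLoopy k ℓ).Indep J ↔ J ⊆ {i : Fin (k + ℓ) | (i : ℕ) < k} := fun J =>
    uniqueBaseOn_indep_iff (subset_univ _)
  rw [hfl]
  constructor
  · rintro h _ ⟨_, ⟨x, hx, rfl⟩, rfl⟩
    exact (he x).2 (h ⟨x, hx, rfl⟩)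
  · rintro h _ ⟨x, hx, rfl⟩
    exact (he x).1 (h ⟨_, ⟨x, hx, rfl⟩, rfl⟩)

lemma aux_pair {M : Matroid α} (h : M.SimpleM) {x y : α} (hx : x ∈ M.E) (hy : y ∈ M.E) :
    M.Indep {x, y} := by
  by_contra hd
  have hd' : M.Dep {x, y} := ⟨hd, by rintro _ (rfl | rfl) <;> assumption⟩
  obtain ⟨C, hC, hCi⟩ := hd'.exists_isCircuit_subset
  have h1 := h C ⟨hCi.subset_ground, hCi.not_indep, fun D hD => hCi.ssubset_indep hD⟩
  have h2 := ncard_le_ncard hC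
  have h3 := ncard_insert_le x {y}
  rw [ncard_singleton] at h3
  omega

universe u

lemma aux_main {F : Type*} [Field F] [Fintype F] {k ℓ : ℕ} (hk : 0 < k)
    {α : Type u} (M : Matroid α) (hfin : M.Finite) (hs : M.SimpleM) (hcs : M✶.SimpleM)
    (hU : M.KLUniform k ℓ) (hrep : RepOver F M) :
    M.E.ncard ≤ Fintype.card F ^ (k * Fintype.card F ^ (ℓ + 1)) + Fintype.card F ^ ℓ + ℓ := by
  classical
  obtain ⟨W, _, _, φ, hφ⟩ := hrep
  set q := Fintype.card F with hq
  have hq1 : 1 ≤ q := Fintype.card_pos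
  have hli : ∀ I ⊆ M.E, (M.Indep I ↔ LinearIndepOn F φ I) := fun I hI =>
    (hφ I hI).trans ⟨fun h => h.2, fun h => ⟨h.injOn, h⟩⟩
  obtain ⟨B', hB'⟩ := M.exists_isBase
  have hEfin := hfin.ground_finite
  obtain ⟨E, hE⟩ := hEfin.exists_finset_coe
  obtain ⟨B, rfl⟩ := (hEfin.subset hB'.subset_ground).exists_finset_coe
  have hBE : B ⊆ E := by
    have := hB'.subset_ground
    rw [← hE] at this
    exact_mod_cast this
  have hcoef : ∀ e, ∃ a : α → F, e ∈ E → φ e = ∑ b ∈ B, a b • φ b := by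
    intro e
    by_cases he : e ∈ E
    swap
    · exact ⟨0, fun h => absurd h he⟩
    have heM : e ∈ M.E := by rw [← hE]; exact he
    have hsp : φ e ∈ Submodule.span F (φ '' (B : Set α)) := by
      by_contra hn
      have hBi := (hli _ hB'.subset_ground).1 hB'.indep
      have hins := hBi.insert hn
      have h1 := (hli _ (insert_subset heM hB'.subset_ground)).2 hins
      have h2 := hB'.eq_of_subset_indep h1 (subset_insert _ _)
      apply hn
      apply Submodule.subset_span
      exact ⟨e, by rw [h2]; exact mem_insert _ _, rfl⟩
    rw [Submodule.mem_span_image_finset_iff_exists_fun] at hsp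
    obtain ⟨c, hc⟩ := hsp
    refine ⟨fun b => if h : b ∈ B then c ⟨b, h⟩ else 0, fun _ => ?_⟩
    rw [← hc, ← Finset.sum_coe_sort B]
    exact Finset.sum_congr rfl fun b _ => by simp
  choose A hA using hcoef
  have hEn : M.E.ncard = E.card := by rw [← hE, ncard_coe_finset]
  have hsplit : E.card = B.card + (E \ B).card := by
    rw [Finset.card_sdiff_of_subset hBE]; have := Finset.card_le_card hBE; omega
  -- simple: bound by rank
  have hbound1 : E.card ≤ q ^ B.card := by
    have hinj : Set.InjOn (fun e => fun b : B => A e b) (E : Set α) := by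
      intro x hx y hy hxy
      have hxy' : φ x = φ y := by
        rw [hA x hx, hA y hy]
        refine Finset.sum_congr rfl fun b hb => ?_
        rw [show A x b = A y b from congrFun hxy ⟨b, hb⟩]
      have hxM : x ∈ M.E := by rw [← hE]; exact hx
      have hyM : y ∈ M.E := by rw [← hE]; exact hy
      have hp := aux_pair hs hxM hyM
      have := (hφ _ hp.subset_ground).1 hp
      exact this.1 (by simp) (by simp) hxy'
    have := Finset.card_le_card_of_injOn (s := E) (t := (Finset.univ : Finset (B → F)))
      (fun e => fun b : B => A e b) (by simp) hinj
    simpa using this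
  -- cosimple: bound by corank
  have hbound2 : B.card ≤ q ^ (E \ B).card := by
    have hinj : Set.InjOn (fun b => fun e : (E \ B : Finset α) => A e b) (B : Set α) := by
      intro x hx y hy hxy
      by_contra hne
      have hxM : x ∈ M.E := hB'.subset_ground hx
      have hyM : y ∈ M.E := hB'.subset_ground hy
      have hp : M✶.Indep {x, y} := aux_pair hcs hxM hyM
      rw [dual_indep_iff_exists'] at hp
      obtain ⟨-, B₂, hB₂, hdis⟩ := hp
      obtain ⟨I, rfl⟩ := (hEfin.subset hB₂.subset_ground).exists_finset_coe
      have hcard := hB₂.ncard_eq_ncard_of_isBase hB'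
      rw [ncard_coe_finset, ncard_coe_finset] at hcard
      have hr := aux_rows (F := F) φ B {x, y} (E \ B) I A
        (fun e he => hA e (Finset.mem_sdiff.1 he).1)
        (by intro z hz; simp only [Finset.mem_insert, Finset.mem_singleton] at hz
            rcases hz with rfl | rfl <;> assumption) (by simp)
        (by
          intro e he s hs s' hs'
          have h0 : A e x = A e y := congrFun hxy ⟨e, he⟩
          simp only [Finset.mem_insert, Finset.mem_singleton] at hs hs'
          rcases hs with rfl | rfl <;> rcases hs' with rfl | rfl <;> simp [h0])
        ((hli _ hB₂.subset_ground).1 hB₂.indep)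
        (by
          intro z hz
          have hzE : z ∈ (E : Set α) := by rw [hE]; exact hB₂.subset_ground hz
          have hzE' : z ∈ E := hzE
          have hz2 : z ∉ ({x, y} : Set α) := fun h => hdis.le_bot ⟨h, hz⟩
          have hz3 : z ∉ ({x, y} : Finset α) := by simpa using hz2
          simp only [Finset.mem_union, Finset.mem_sdiff]
          tauto)
      rw [Finset.card_pair hne] at hr
      omega
    have := Finset.card_le_card_of_injOn (s := B)
      (t := (Finset.univ : Finset ((E \ B : Finset α) → F)))
      (fun b => fun e : (E \ B : Finset α) => A e b) (by simp) hinj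
    simpa using this
  rw [hEn]
  by_cases h1 : B.card ≤ k * q ^ (ℓ + 1)
  · have := Nat.pow_le_pow_right hq1 h1
    omega
  by_cases h2 : (E \ B).card ≤ ℓ
  · have := Nat.pow_le_pow_right hq1 h2
    omega
  exfalso
  push Not at h1 h2
  obtain ⟨T, hTs, hTc⟩ := Finset.exists_subset_card_eq (s := E \ B) (n := ℓ + 1) h2
  obtain ⟨v, -, hv⟩ := Finset.exists_lt_card_fiber_of_mul_lt_card_of_maps_to
    (s := B) (t := (Finset.univ : Finset (T → F))) (f := fun b => fun e : T => A e b) (n := k)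
    (by simp) (by simp [hTc]; rw [mul_comm]; exact h1)
  obtain ⟨S, hSs, hSc⟩ := Finset.exists_subset_card_eq (n := k + 1) hv
  have hSB : S ⊆ B := fun s hs => (Finset.mem_filter.1 (hSs hs)).1
  have hrow : ∀ e ∈ T, ∀ s ∈ S, ∀ s' ∈ S, A e s = A e s' := by
    intro e he s hs s' hs'
    have h3 := (Finset.mem_filter.1 (hSs hs)).2
    have h4 := (Finset.mem_filter.1 (hSs hs')).2
    exact congrFun (h3.trans h4.symm) ⟨e, he⟩
  have hTE : T ⊆ E := hTs.trans Finset.sdiff_subset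
  set X : Finset α := (B \ S) ∪ T with hX
  have hXE : X ⊆ E := Finset.union_subset (Finset.sdiff_subset.trans hBE) hTE
  have hXM : (X : Set α) ⊆ M.E := by rw [← hE]; exact_mod_cast hXE
  have hXc : X.card = B.card - (k + 1) + (ℓ + 1) := by
    rw [hX, Finset.card_union_of_disjoint, Finset.card_sdiff_of_subset hSB, hSc, hTc]
    exact (Finset.disjoint_sdiff.mono_right hTs).mono_left Finset.sdiff_subset
  obtain ⟨C', hC'⟩ := M.exists_isBasis (X : Set α) hXM
  obtain ⟨C, rfl⟩ := (X.finite_toSet.subset hC'.subset).exists_finset_coe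
  have hCX : C ⊆ X := by exact_mod_cast hC'.subset
  have hr := aux_rows (F := F) φ B S T C A (fun e he => hA e (hTE he)) hSB
    (Finset.card_pos.1 (by omega)) hrow ((hli _ hC'.indep.subset_ground).1 hC'.indep) hCX
  have hBS := Finset.card_le_card hSB
  obtain ⟨L, hLs, hLc⟩ := Finset.exists_subset_card_eq (s := X \ C) (n := ℓ)
    (by rw [Finset.card_sdiff_of_subset hCX]; omega)
  obtain ⟨B₂', hB₂, hCB⟩ := hC'.indep.exists_isBase_superset
  obtain ⟨B₂, rfl⟩ := (hEfin.subset hB₂.subset_ground).exists_finset_coe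
  have hCB' : C ⊆ B₂ := by exact_mod_cast hCB
  have hcard := hB₂.ncard_eq_ncard_of_isBase hB'
  rw [ncard_coe_finset, ncard_coe_finset] at hcard
  obtain ⟨Q, hQs, hQc⟩ := Finset.exists_subset_card_eq (s := B₂ \ C) (n := k)
    (by rw [Finset.card_sdiff_of_subset hCB']; omega)
  have hdep : ∀ x ∈ L, x ∈ M.E ∧ ¬ M.Indep (insert x (C : Set α)) := by
    intro x hx
    have hx' := Finset.mem_sdiff.1 (hLs hx)
    refine ⟨hXM hx'.1, fun hi => hx'.2 ?_⟩
    exact hC'.mem_of_insert_indep hx'.1 hi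
  have hQB : Q ⊆ B₂ := hQs.trans Finset.sdiff_subset
  refine aux_iso (M := M) (k := k) (ℓ := ℓ) (C := C) (A := Q) (L := L) ?_ ?_ ?_ ?_ hQc hLc hdep hU
  · exact hB₂.indep.subset (union_subset hCB (by exact_mod_cast hQB))
  · exact Finset.disjoint_sdiff.mono_right hQs
  · exact Finset.disjoint_sdiff.mono_right hLs
  · rw [Finset.disjoint_left]
    intro x hxQ hxL
    exact (hdep x hxL).2 (hB₂.indep.subset (insert_subset (hQB hxQ) hCB))

/-- for positive `k, ℓ` and a prime power `q = p ^ c`, there is a bound on the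
number of elements of a simple cosimple `(k,ℓ)`-uniform `GF(q)`-representable matroid. -/
theorem stmt9 (k ℓ p c : ℕ) [Fact p.Prime] (hc : c ≠ 0) (hk : 0 < k) (hℓ : 0 < ℓ) :
    ∃ n : ℕ, ∀ (α : Type u) (M : Matroid α), M.Finite → M.SimpleM → M✶.SimpleM →
      M.KLUniform k ℓ → Matroid.RepOver (GaloisField p c) M → M.E.ncard ≤ n := by
  classical
  haveI : Fintype (GaloisField p c) := Fintype.ofFinite _
  exact ⟨_, fun α M h1 h2 h3 h4 h5 => aux_main (F := GaloisField p c) hk M h1 h2 h3 h4 h5⟩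

end Matroid
end

section
/- Let q be a prime power. There exists a natural number n such that every excluded minor for GF(q)-representability has at most n elements in its ground set if and only if there exists a pair (k,ℓ) of positive integers such that every excluded minor for GF(q)-representability is (k,ℓ)-uniform. -/
open Set

namespace Matroid

variable {α β : Type*}

/-- A matroid is an excluded minor for representability over `𝔽` if it is not representable
over `𝔽` but every proper minor of it is. -/
def ExcludedMinorFor (𝔽 : Type*) [Field 𝔽] {α : Type*} (M : Matroid α) : Prop :=
  ¬ Matroid.RepOver 𝔽 M ∧ ∀ N : Matroid α, N.IsMinorOf M → N ≠ M → Matroid.RepOver 𝔽 N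

section Helpers

/-- `φ` represents `M`. -/
def RepBy (𝔽 : Type) [Field 𝔽] {W : Type} [AddCommGroup W] [Module 𝔽 W] (M : Matroid α)
    (φ : α → W) : Prop :=
  ∀ I ⊆ M.E, (M.Indep I ↔ LinearIndepOn 𝔽 φ I)

variable {𝔽 : Type} [Field 𝔽] {W : Type} [AddCommGroup W] [Module 𝔽 W] {φ : α → W} {M : Matroid α}

lemma repOver_iff : RepOver 𝔽 M ↔ ∃ (W : Type) (_ : AddCommGroup W) (_ : Module 𝔽 W) (φ : α → W),
    RepBy 𝔽 M φ := by
  constructor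
  · rintro ⟨W, i, j, φ, h⟩
    refine ⟨W, i, j, φ, fun I hI => ?_⟩
    rw [h I hI]
    exact ⟨fun h => h.2, fun h => ⟨LinearIndepOn.injOn h, h⟩⟩
  · rintro ⟨W, i, j, φ, h⟩
    refine ⟨W, i, j, φ, fun I hI => ?_⟩
    rw [h I hI]
    exact ⟨fun h => ⟨LinearIndepOn.injOn h, h⟩, fun h => h.2⟩

lemma RepBy.mem_closure_indep (h : RepBy 𝔽 M φ) {I : Set α} {x : α} (hI : M.Indep I) (hx : x ∈ M.E) :
    x ∈ M.closure I ↔ φ x ∈ Submodule.span 𝔽 (φ '' I) := by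
  by_cases hxI : x ∈ I
  · exact iff_of_true (M.mem_closure_of_mem hxI hI.subset_ground)
      (Submodule.subset_span (mem_image_of_mem _ hxI))
  have h1 := hI.insert_indep_iff_of_notMem hxI
  rw [h _ (insert_subset hx hI.subset_ground), linearIndepOn_insert hxI,
    and_iff_right ((h _ hI.subset_ground).1 hI)] at h1
  have : φ x ∉ Submodule.span 𝔽 (φ '' I) ↔ x ∉ M.closure I := by
    rw [h1]; exact ⟨fun h => h.2, fun h => ⟨hx, h⟩⟩
  tauto

lemma RepBy.mem_span (h : RepBy 𝔽 M φ) {X : Set α} {x : α} (hX : X ⊆ M.E) (hx : x ∈ M.closure X) :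
    φ x ∈ Submodule.span 𝔽 (φ '' X) := by
  obtain ⟨I, hI⟩ := M.exists_isBasis X
  rw [← hI.closure_eq_closure] at hx
  have := (h.mem_closure_indep hI.indep (mem_ground_of_mem_closure hx)).1 hx
  exact Submodule.span_mono (image_mono hI.subset) this

lemma RepBy.mem_closure (h : RepBy 𝔽 M φ) {X : Set α} {x : α} (hX : X ⊆ M.E) (hx : x ∈ M.E)
    (hs : φ x ∈ Submodule.span 𝔽 (φ '' X)) : x ∈ M.closure X := by
  obtain ⟨I, hI⟩ := M.exists_isBasis X
  rw [← hI.closure_eq_closure, h.mem_closure_indep hI.indep hx]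
  refine Submodule.span_le.2 ?_ hs
  rintro _ ⟨y, hy, rfl⟩
  refine (h.mem_closure_indep hI.indep (hX hy)).1 ?_
  rw [hI.closure_eq_closure]
  exact M.mem_closure_of_mem hy hX

lemma repOver_of_ext {x : α} (hx : x ∈ M.E) (h : RepBy 𝔽 (M ＼ {x}) φ) (w : W)
    (hw : ∀ I, M.Indep I → x ∉ I → (M.Indep (insert x I) ↔ w ∉ Submodule.span 𝔽 (φ '' I))) :
    RepOver 𝔽 M := by
  classical
  refine repOver_iff.2 ⟨W, inferInstance, inferInstance, Function.update φ x w, ?_⟩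
  have key : ∀ I ⊆ M.E, x ∉ I →
      (M.Indep I ↔ LinearIndepOn 𝔽 (Function.update φ x w) I) := by
    intro I hI hxI
    have h1 := h I (by simpa [subset_sdiff] using ⟨hI, hxI⟩)
    rw [deleteElem_indep_iff, and_iff_left hxI] at h1
    rw [h1]
    refine linearIndepOn_congr fun y hy => ?_
    rw [Function.update_of_ne]
    rintro rfl; exact hxI hy
  intro I hI
  by_cases hxI : x ∈ I
  · obtain ⟨J, rfl, hxJ⟩ : ∃ J, insert x J = I ∧ x ∉ J := ⟨I \ {x}, by simp [hxI], by simp⟩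
    have hJ : J ⊆ M.E := (subset_insert _ _).trans hI
    rw [linearIndepOn_insert hxJ, ← key J hJ hxJ, Function.update_self]
    have him : Function.update φ x w '' J = φ '' J := by
      refine image_congr fun y hy => ?_
      rw [Function.update_of_ne]
      rintro rfl; exact hxJ hy
    rw [him]
    constructor
    · intro hi
      have := hi.subset (subset_insert _ _)
      exact ⟨this, (hw J this hxJ).1 hi⟩
    · rintro ⟨h1, h2⟩
      exact (hw J h1 hxJ).2 h2
  · exact key I hI hxI

lemma repOver_of_loop {x : α} (hx : M.IsLoop x) (h : RepOver 𝔽 (M ＼ {x})) : RepOver 𝔽 M := by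
  obtain ⟨W, _, _, φ, h⟩ := repOver_iff.1 h
  refine repOver_of_ext hx.mem_ground h 0 fun I hI hxI => ?_
  refine iff_of_false (fun hi => ?_) (by simp)
  exact hx.not_isNonloop (hi.isNonloop_of_mem (mem_insert _ _))

lemma repOver_of_parallel {x y : α} (hxy : x ≠ y) (hx : M.IsNonloop x) (hy : M.IsNonloop y)
    (hd : ¬ M.Indep {x, y}) (h : RepOver 𝔽 (M ＼ {x})) : RepOver 𝔽 M := by
  obtain ⟨W, _, _, φ, h⟩ := repOver_iff.1 h
  have hcl1 : x ∈ M.closure {y} := by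
    by_contra hcon
    exact hd ((hy.indep.insert_indep_iff_of_notMem (by simpa)).2 ⟨hx.mem_ground, hcon⟩)
  have hcl2 : y ∈ M.closure {x} := by
    by_contra hcon
    apply hd
    rw [pair_comm]
    exact ((hx.indep.insert_indep_iff_of_notMem (by simpa using hxy.symm)).2 ⟨hy.mem_ground, hcon⟩)
  refine repOver_of_ext hx.mem_ground h (φ y) fun I hI hxI => ?_
  rw [hI.insert_indep_iff_of_notMem hxI, ← h.mem_closure_indep
    (deleteElem_indep_iff.2 ⟨hI, hxI⟩) (by simpa using ⟨hy.mem_ground, hxy.symm⟩), delete_closure_eq]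
  have hI' : I \ {x} = I := by simp [hxI]
  rw [hI']
  have : x ∈ M.closure I ↔ y ∈ M.closure I := by
    constructor
    · intro hh
      exact M.closure_subset_closure_of_subset_closure (by simpa using hh) hcl2
    · intro hh
      exact M.closure_subset_closure_of_subset_closure (by simpa using hh) hcl1
  have hne := hxy.symm
  simp only [mem_sdiff, mem_singleton_iff, this, hx.mem_ground, hne]
  tauto

lemma repOver_of_series {e f : α} (hef : e ≠ f) (he : e ∈ M.E) (hf : f ∈ M.E)
    (hse : e ∉ M.closure (M.E \ {e, f})) (hsf : f ∉ M.closure (M.E \ {e, f}))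
    (h : RepOver 𝔽 (M ／ {e})) : RepOver 𝔽 M := by
  classical
  obtain ⟨W, _, _, φ, h⟩ := repOver_iff.1 h
  have hie : ∀ J, M.Indep J → e ∉ J → f ∉ J → M.Indep (insert e J) := by
    intro J hJ h1 h2
    refine (hJ.insert_indep_iff_of_notMem h1).2 ⟨he, fun hc => hse ?_⟩
    refine M.closure_subset_closure ?_ hc
    intro y hy
    exact ⟨hJ.subset_ground hy, by rintro (rfl | rfl) <;> contradiction⟩
  have hif : ∀ J, M.Indep J → e ∉ J → f ∉ J → M.Indep (insert f J) := by
    intro J hJ h1 h2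
    refine (hJ.insert_indep_iff_of_notMem h2).2 ⟨hf, fun hc => hsf ?_⟩
    refine M.closure_subset_closure ?_ hc
    intro y hy
    exact ⟨hJ.subset_ground hy, by rintro (rfl | rfl) <;> contradiction⟩
  have hnl : M.IsNonloop e := by
    have := hie ∅ M.empty_indep (by simp) (by simp)
    rw [← indep_singleton]; simpa using this
  have hrep : ∀ J ⊆ M.E, e ∉ J → (M.Indep (insert e J) ↔ LinearIndepOn 𝔽 φ J) := by
    intro J hJ heJ
    rw [← h J (by simpa [subset_sdiff] using ⟨hJ, heJ⟩), hnl.contractElem_indep_iff,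
      and_iff_right heJ]
  let ψ : α → W × 𝔽 := fun x => if x = e then (0, 1) else if x = f then (φ f, 1) else (φ x, 0)
  have hψe : ψ e = (0, 1) := by simp [ψ]
  have hψf : ψ f = (φ f, 1) := by simp [ψ, hef.symm]
  have hψ : ∀ x, x ≠ e → x ≠ f → ψ x = (φ x, 0) := fun x h1 h2 => by simp [ψ, h1, h2]
  have hψ1 : ∀ x, x ≠ e → (ψ x).1 = φ x := by
    intro x h1
    by_cases h2 : x = f
    · subst h2; rw [hψf]
    · rw [hψ x h1 h2]
  have ne_of {J : Set α} {a : α} (ha : a ∉ J) : ∀ y ∈ J, y ≠ a := by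
    rintro y hy rfl; exact ha hy
  have fact1 : ∀ J, e ∉ J → (LinearIndepOn 𝔽 ψ (insert e J) ↔ LinearIndepOn 𝔽 φ J) := by
    intro J heJ
    have hcongr : LinearIndepOn 𝔽 φ J ↔ LinearIndepOn 𝔽 (LinearMap.fst 𝔽 W 𝔽 ∘ ψ) J :=
      linearIndepOn_congr fun y hy => by simp [hψ1 y (ne_of heJ y hy)]
    rw [linearIndepOn_insert heJ, hψe, hcongr]
    constructor
    · rintro ⟨h1, h2⟩
      refine h1.map_injOn _ ?_
      refine LinearMap.injOn_of_disjoint_ker le_rfl ?_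
      rw [Submodule.disjoint_def]
      rintro ⟨a, b⟩ hx hk
      have ha : a = 0 := by simpa using hk
      subst ha
      by_contra hne
      have hb : b ≠ 0 := fun hb => hne (by simp [hb])
      apply h2
      have := Submodule.smul_mem _ b⁻¹ hx
      simpa [hb] using this
    · intro h1
      refine ⟨LinearIndependent.of_comp (LinearMap.fst 𝔽 W 𝔽) h1, fun hmem => ?_⟩
      rw [Finsupp.mem_span_image_iff_linearCombination] at hmem
      obtain ⟨l, hl, hlc⟩ := hmem
      have h0 : l = 0 := by
        refine (linearIndepOn_iff.1 h1) l hl ?_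
        have := congrArg (LinearMap.fst 𝔽 W 𝔽) hlc
        rw [Finsupp.apply_linearCombination] at this
        simpa using this
      subst h0
      have h01 := congrArg Prod.snd hlc
      simp at h01
  have fact2 : ∀ J, e ∉ J → f ∉ J → (LinearIndepOn 𝔽 ψ J ↔ LinearIndepOn 𝔽 φ J) := by
    intro J heJ hfJ
    have hcongr : LinearIndepOn 𝔽 ψ J ↔ LinearIndepOn 𝔽 (LinearMap.inl 𝔽 W 𝔽 ∘ φ) J :=
      linearIndepOn_congr fun y hy => by simp [hψ y (ne_of heJ y hy) (ne_of hfJ y hy)]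
    rw [hcongr]
    exact LinearMap.linearIndepOn_iff_of_injOn _ (LinearMap.inl_injective.injOn)
  have fact3 : ∀ J, e ∉ J → f ∉ J → (LinearIndepOn 𝔽 ψ (insert f J) ↔ LinearIndepOn 𝔽 ψ J) := by
    intro J heJ hfJ
    rw [linearIndepOn_insert hfJ]
    refine and_iff_left fun hmem => ?_
    have : Submodule.span 𝔽 (ψ '' J) ≤ LinearMap.ker (LinearMap.snd 𝔽 W 𝔽) := by
      rw [Submodule.span_le]
      rintro _ ⟨y, hy, rfl⟩
      simp [hψ y (ne_of heJ y hy) (ne_of hfJ y hy)]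
    have := this hmem
    simp [hψf] at this
  refine repOver_iff.2 ⟨W × 𝔽, inferInstance, inferInstance, ψ, fun I hI => ?_⟩
  have key : ∀ J ⊆ M.E, e ∉ J → f ∉ J → (M.Indep J ↔ LinearIndepOn 𝔽 ψ J) := by
    intro J hJ h1 h2
    rw [fact2 J h1 h2, ← hrep J hJ h1]
    exact ⟨fun h => hie J h h1 h2, fun h => h.subset (subset_insert _ _)⟩
  by_cases heI : e ∈ I
  · obtain ⟨J, rfl, hJ⟩ : ∃ J, insert e J = I ∧ e ∉ J := ⟨I \ {e}, by simp [heI], by simp⟩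
    rw [fact1 J hJ, hrep J ((subset_insert _ _).trans hI) hJ]
  by_cases hfI : f ∈ I
  · obtain ⟨J, rfl, hJ⟩ : ∃ J, insert f J = I ∧ f ∉ J := ⟨I \ {f}, by simp [hfI], by simp⟩
    have heJ : e ∉ J := fun h => heI (mem_insert_of_mem _ h)
    rw [fact3 J heJ hJ, ← key J ((subset_insert _ _).trans hI) heJ hJ]
    exact ⟨fun h => h.subset (subset_insert _ _), fun h => hif J h heJ hJ⟩
  · exact key I hI heI hfI

lemma isMinorOf_iff {N : Matroid α} : N.IsMinorOf M ↔ N ≤m M := by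
  constructor
  · rintro ⟨C, D, -, -, -, rfl⟩
    exact ⟨C, D, rfl⟩
  · intro h
    obtain ⟨C, D, h1, h2, h3, h4⟩ := h.exists_eq_contract_delete_disjoint
    exact ⟨C, D, h1, h2, h3, h4⟩

lemma KLUniform.minor {N : Matroid α} {k ℓ : ℕ} (h : M.KLUniform k ℓ) (hN : N ≤m M) :
    N.KLUniform k ℓ := by
  rintro ⟨N', h1, h2⟩
  exact h ⟨N', isMinorOf_iff.2 ((isMinorOf_iff.1 h1).trans hN), h2⟩

lemma isoTo_freeLoopy {N : Matroid α} {K L : Set α} {k ℓ : ℕ} (hE : N.E = K ∪ L)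
    (hdj : Disjoint K L) (hKf : K.Finite) (hLf : L.Finite) (hK : K.ncard = k) (hL : L.ncard = ℓ)
    (hind : ∀ J ⊆ K ∪ L, N.Indep J ↔ J ⊆ K) : N.IsoTo (freeLoopy k ℓ) := by
  classical
  have := hKf.to_subtype
  have := hLf.to_subtype
  let eK : K ≃ Fin k := Finite.equivFinOfCardEq hK
  let eL : L ≃ Fin ℓ := Finite.equivFinOfCardEq hL
  let e1 : N.E ≃ Fin (k + ℓ) :=
    (Equiv.setCongr hE).trans ((Equiv.Set.union hdj).trans
      ((Equiv.sumCongr eK eL).trans finSumFinEquiv))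
  have he1 : ∀ x : N.E, ((e1 x : ℕ) < k ↔ (x : α) ∈ K) := by
    rintro ⟨x, hx⟩
    by_cases hxK : x ∈ K
    · have : e1 ⟨x, hx⟩ = Fin.castAdd ℓ (eK ⟨x, hxK⟩) := by
        have h0 : e1 ⟨x, hx⟩ = finSumFinEquiv ((Equiv.sumCongr eK eL)
          (Equiv.Set.union hdj ⟨x, (hE ▸ hx : x ∈ K ∪ L)⟩)) := rfl
        rw [h0, Equiv.Set.union_apply_left hdj (a := ⟨x, _⟩) hxK]
        simp
      rw [this]
      simp [hxK]
    · have hxL : x ∈ L := (hE ▸ hx : x ∈ K ∪ L).resolve_left hxK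
      have : e1 ⟨x, hx⟩ = Fin.natAdd k (eL ⟨x, hxL⟩) := by
        have h0 : e1 ⟨x, hx⟩ = finSumFinEquiv ((Equiv.sumCongr eK eL)
          (Equiv.Set.union hdj ⟨x, (hE ▸ hx : x ∈ K ∪ L)⟩)) := rfl
        rw [h0, Equiv.Set.union_apply_right hdj (a := ⟨x, _⟩) hxL]
        simp
      rw [this]
      simp [hxK]
  refine ⟨e1.trans (Equiv.Set.univ _).symm, fun I => ?_⟩
  rw [hind _ (by rw [← hE]; rintro _ ⟨x, -, rfl⟩; exact x.2)]
  have hfl : ∀ J, (freeLoopy k ℓ).Indep J ↔ J ⊆ {i : Fin (k + ℓ) | (i : ℕ) < k} :=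
    fun J => uniqueBaseOn_indep_iff (subset_univ _)
  refine Iff.trans ?_ (hfl _).symm
  constructor
  · rintro h _ ⟨_, ⟨x, hx, rfl⟩, rfl⟩
    exact (he1 x).2 (h ⟨x, hx, rfl⟩)
  · rintro h _ ⟨x, hx, rfl⟩
    exact (he1 x).1 (h ⟨_, ⟨x, hx, rfl⟩, rfl⟩)

lemma KLUniform.bound {k ℓ : ℕ} (hfin : M.Finite) (hu : M.KLUniform k ℓ) {I X B : Set α}
    (hI : M.IsBasis I X) (hB : M.IsBase B) (hIB : I ⊆ B) (hk : k ≤ (B \ I).ncard) :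
    (X \ I).ncard < ℓ := by
  by_contra! hcon
  obtain ⟨K, hK, hKc⟩ := Set.exists_subset_card_eq hk
  obtain ⟨L, hL, hLc⟩ := Set.exists_subset_card_eq hcon
  have hXE := hI.subset_ground
  have hBE := hB.subset_ground
  have hLX : L ⊆ X := hL.trans sdiff_subset
  have hKB : K ⊆ B := hK.trans sdiff_subset
  have hKI : Disjoint K I := disjoint_of_subset_left hK disjoint_sdiff_left
  have hLI : Disjoint L I := disjoint_of_subset_left hL disjoint_sdiff_left
  have hnot : ∀ x ∈ L, ¬ M.Indep (insert x I) := fun x hx hi => by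
    have := hI.mem_of_insert_indep (hLX hx) hi
    exact hLI.notMem_of_mem_left hx this
  have hdj : Disjoint K L := by
    rw [Set.disjoint_left]
    intro x hxK hxL
    exact hnot x hxL (hB.indep.subset (insert_subset (hKB hxK) hIB))
  have hKLI : Disjoint (K ∪ L) I := disjoint_union_left.2 ⟨hKI, hLI⟩
  have hKLE : K ∪ L ⊆ M.E := union_subset (hKB.trans hBE) (hLX.trans hXE)
  apply hu
  refine ⟨M ／ I ＼ ((M.E \ I) \ (K ∪ L)), isMinorOf_iff.2 ⟨_, _, rfl⟩, ?_⟩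
  refine isoTo_freeLoopy (K := K) (L := L) ?_ hdj (hfin.ground_finite.subset (hKB.trans hBE))
    (hfin.ground_finite.subset (hLX.trans hXE)) hKc hLc ?_
  · rw [delete_ground, contract_ground, sdiff_sdiff_cancel_left]
    exact subset_sdiff.2 ⟨hKLE, hKLI⟩
  · intro J hJ
    rw [delete_indep_iff, hI.indep.contract_indep_iff]
    have h1 : Disjoint J ((M.E \ I) \ (K ∪ L)) := disjoint_of_subset_left hJ disjoint_sdiff_right
    have h2 : Disjoint J I := disjoint_of_subset_left hJ hKLI
    simp only [h1, h2, true_and, and_true]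
    constructor
    · intro hi x hx
      refine (hJ hx).resolve_right fun hxL => hnot x hxL (hi.subset ?_)
      exact insert_subset (Or.inl hx) subset_union_right
    · intro hJK
      exact hB.indep.subset (union_subset (hJK.trans hKB) hIB)

lemma card_span_le [Finite 𝔽] {ι : Type*} (v : ι → W) (s : Set ι) (hs : s.Finite) :
    (Submodule.span 𝔽 (v '' s) : Set W).Finite ∧
      (Submodule.span 𝔽 (v '' s) : Set W).ncard ≤ Nat.card 𝔽 ^ s.ncard := by
  classical
  have hvs : (v '' s).Finite := hs.image v
  have : Module.Finite 𝔽 (Submodule.span 𝔽 (v '' s)) := FiniteDimensional.span_of_finite 𝔽 hvs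
  have hf : Finite (Submodule.span 𝔽 (v '' s)) := Module.finite_of_finite 𝔽
  refine ⟨hf, ?_⟩
  have h1 := Module.natCard_eq_pow_finrank (K := 𝔽) (V := Submodule.span 𝔽 (v '' s))
  have : Fintype (v '' s) := hvs.fintype
  have h2 := finrank_span_le_card (R := 𝔽) (v '' s)
  rw [← Set.ncard_eq_toFinset_card'] at h2
  have h3 : (v '' s).ncard ≤ s.ncard := Set.ncard_image_le hs
  have h4 : (Submodule.span 𝔽 (v '' s) : Set W).ncard = Nat.card (Submodule.span 𝔽 (v '' s)) := rfl
  rw [h4, h1]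
  exact Nat.pow_le_pow_right Nat.card_pos (h2.trans h3)

/-- corank bound -/
lemma corank_bound [Finite 𝔽] {k ℓ : ℕ} (hfin : M.Finite) (hu : M.KLUniform k ℓ)
    (h : RepBy 𝔽 M φ) {B : Set α} (hB : M.IsBase B) (hk : k + 1 ≤ B.ncard) :
    (M.E \ B).ncard ≤ Nat.card 𝔽 ^ (k + 1) * ℓ := by
  classical
  obtain ⟨K, hK, hKc⟩ := Set.exists_subset_card_eq hk
  have hEf := hfin.ground_finite
  have hBf := hEf.subset hB.subset_ground
  have hKf := hBf.subset hK
  set C : Set α := B \ K with hC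
  have hCB : C ⊆ B := sdiff_subset
  have hCE : C ⊆ M.E := hCB.trans hB.subset_ground
  have hCc : C.ncard + (k + 1) = B.ncard := by
    rw [← hKc]; exact Set.ncard_sdiff_add_ncard_of_subset hK hBf
  let U := Submodule.span 𝔽 (φ '' C)
  let v : α → W ⧸ U := fun x => U.mkQ (φ x)
  obtain ⟨hSf, hSc⟩ := card_span_le (𝔽 := 𝔽) v K hKf
  rw [hKc] at hSc
  set S : Set (W ⧸ U) := (Submodule.span 𝔽 (v '' K) : Set (W ⧸ U)) with hS
  have hDf : (M.E \ B).Finite := hEf.subset sdiff_subset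
  by_contra! hcon
  have hmaps : ∀ x ∈ M.E, v x ∈ S := by
    intro x hx
    have h1 : φ x ∈ Submodule.span 𝔽 (φ '' B) :=
      h.mem_span hB.subset_ground (by rw [hB.closure_eq]; exact hx)
    have h2 : v x ∈ (Submodule.span 𝔽 (φ '' B)).map U.mkQ := Submodule.mem_map_of_mem h1
    rw [Submodule.map_span] at h2
    refine Submodule.span_le.2 ?_ h2
    rintro _ ⟨_, ⟨b, hb, rfl⟩, rfl⟩
    by_cases hbK : b ∈ K
    · exact Submodule.subset_span ⟨b, hbK, rfl⟩
    · have : φ b ∈ U := Submodule.subset_span ⟨b, ⟨hb, hbK⟩, rfl⟩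
      have : U.mkQ (φ b) = 0 := by simpa using this
      rw [this]; exact Submodule.zero_mem _
  obtain ⟨y, -, hy⟩ := Finset.exists_lt_card_fiber_of_mul_lt_card_of_maps_to
    (s := hDf.toFinset) (t := hSf.toFinset) (f := v) (n := ℓ)
    (fun a ha => by
      rw [Set.Finite.mem_toFinset] at ha ⊢
      exact hmaps a ha.1)
    (by
      rw [← Set.ncard_eq_toFinset_card _ hDf, ← Set.ncard_eq_toFinset_card _ hSf]
      exact lt_of_le_of_lt (Nat.mul_le_mul_right _ hSc) hcon)
  set T := {x ∈ hDf.toFinset | v x = y} with hT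
  have hTmem : ∀ x ∈ T, x ∈ M.E ∧ x ∉ B ∧ v x = y := by
    intro x hx
    simp only [hT, Finset.mem_filter, Set.Finite.mem_toFinset] at hx
    exact ⟨hx.1.1, hx.1.2, hx.2⟩
  obtain ⟨x0, hx0⟩ : T.Nonempty := Finset.card_pos.1 (by omega)
  have hx0' := hTmem x0 hx0
  have hXE : insert x0 C ⊆ M.E := insert_subset hx0'.1 hCE
  obtain ⟨I, hI, hCI⟩ := (hB.indep.subset hCB).subset_isBasis_of_subset (subset_insert x0 C) hXE
  obtain ⟨B', hB', hIB', -⟩ := hI.indep.exists_isBase_subset_union_isBase hB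
  have hIf := hEf.subset hI.indep.subset_ground
  have hB'f := hEf.subset hB'.subset_ground
  have hIc : I.ncard ≤ C.ncard + 1 :=
    (Set.ncard_le_ncard hI.subset (hEf.subset hXE)).trans (Set.ncard_insert_le _ _)
  have hBB' := hB.ncard_eq_ncard_of_isBase hB'
  have h1 := Set.ncard_sdiff_add_ncard_of_subset hIB' hB'f
  have hcl : ∀ x ∈ T, x ∈ M.closure I := by
    intro x hx
    rw [hI.closure_eq_closure]
    have hx' := hTmem x hx
    refine h.mem_closure hXE hx'.1 ?_
    have : φ x - φ x0 ∈ U := by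
      rw [← Submodule.Quotient.eq]
      exact hx'.2.2.trans hx0'.2.2.symm
    rw [← sub_add_cancel (φ x) (φ x0)]
    refine Submodule.add_mem _ (Submodule.span_mono (image_mono (subset_insert _ _)) this)
      (Submodule.subset_span ⟨x0, mem_insert _ _, rfl⟩)
  have hb := KLUniform.bound hfin hu hI.isBasis_closure_right hB' hIB' (by omega)
  rw [← hI.closure_eq_closure] at hb
  have hsub : ((T.erase x0 : Finset α) : Set α) ⊆ M.closure I \ I := by
    intro x hx
    have hx := Finset.mem_erase.1 (Finset.mem_coe.1 hx)
    refine ⟨hcl x hx.2, fun hxI => ?_⟩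
    rcases hI.subset hxI with h | h
    · exact hx.1 h
    · exact (hTmem x hx.2).2.1 (hCB h)
  have hle := Set.ncard_le_ncard hsub (hEf.subset (sdiff_subset.trans (M.closure_subset_ground I)))
  rw [Set.ncard_coe_finset, Finset.card_erase_of_mem hx0] at hle
  omega

lemma exists_coord {B : Set α} (hB : LinearIndepOn 𝔽 φ B) :
    ∃ g : W →ₗ[𝔽] (B →₀ 𝔽), ∀ b : B, g (φ b) = Finsupp.single b 1 := by
  obtain ⟨g, hg⟩ := LinearMap.exists_leftInverse_of_injective
    (Finsupp.linearCombination 𝔽 (fun b : B => φ b)) (LinearMap.ker_eq_bot.2 hB)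
  refine ⟨g, fun b => ?_⟩
  have := LinearMap.congr_fun hg (Finsupp.single b 1)
  simpa using this

/-- If the base is large compared with its complement, there is a series pair. -/
lemma exists_series [Finite 𝔽] (hfin : M.Finite) (h : RepBy 𝔽 M φ) {B : Set α} (hB : M.IsBase B)
    (hlt : Nat.card 𝔽 ^ (M.E \ B).ncard < B.ncard) :
    ∃ e f, e ∈ B ∧ f ∈ B ∧ e ≠ f ∧ e ∉ M.closure (M.E \ {e, f}) ∧
      f ∉ M.closure (M.E \ {e, f}) := by
  classical
  have hEf := hfin.ground_finite
  have hBf := hEf.subset hB.subset_ground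
  have : Finite (M.E \ B : Set α) := (hEf.subset sdiff_subset).to_subtype
  have : Finite B := hBf.to_subtype
  obtain ⟨g, hg⟩ := exists_coord ((h B hB.subset_ground).1 hB.indep)
  let c : B → ((M.E \ B : Set α) → 𝔽) := fun b x => g (φ x) b
  have hni : ¬ Function.Injective c := by
    intro hi
    have := Nat.card_le_card_of_injective c hi
    rw [Nat.card_fun] at this
    exact absurd this (not_le.2 hlt)
  simp only [Function.Injective, not_forall] at hni
  obtain ⟨e, f, hcef, hef⟩ := hni
  have hef' : (e : α) ≠ f := fun h => hef (Subtype.ext h)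
  let lam : W →ₗ[𝔽] 𝔽 := (Finsupp.lapply e - Finsupp.lapply f) ∘ₗ g
  have hlam : ∀ x, lam (φ x) = g (φ x) e - g (φ x) f := fun x => rfl
  have hker : Submodule.span 𝔽 (φ '' (M.E \ {(e : α), (f : α)})) ≤ LinearMap.ker lam := by
    rw [Submodule.span_le]
    rintro _ ⟨x, ⟨hxE, hx⟩, rfl⟩
    simp only [mem_insert_iff, mem_singleton_iff, not_or] at hx
    rw [SetLike.mem_coe, LinearMap.mem_ker, hlam]
    by_cases hxB : x ∈ B
    · have h1 := hg ⟨x, hxB⟩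
      simp only at h1
      rw [h1, Finsupp.single_eq_of_ne, Finsupp.single_eq_of_ne, sub_zero]
      · intro h; exact hx.2 (congrArg Subtype.val h).symm
      · intro h; exact hx.1 (congrArg Subtype.val h).symm
    · exact sub_eq_zero.2 (congrFun hcef ⟨x, hxE, hxB⟩)
  have hcl : ∀ z, z ∈ M.closure (M.E \ {(e : α), (f : α)}) → lam (φ z) = 0 :=
    fun z hz => hker (h.mem_span sdiff_subset hz)
  refine ⟨e, f, e.2, f.2, hef', fun hc => ?_, fun hc => ?_⟩
  · have := hcl _ hc
    rw [hlam, hg, Finsupp.single_eq_same, Finsupp.single_eq_of_ne (Ne.symm hef)] at this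
    simp at this
  · have := hcl _ hc
    rw [hlam, hg, Finsupp.single_eq_same, Finsupp.single_eq_of_ne hef] at this
    simp at this

lemma excluded_bound [Finite 𝔽] {k ℓ : ℕ} (hfin : M.Finite) (hex : ExcludedMinorFor 𝔽 M)
    (hu : M.KLUniform k ℓ) :
    M.E.ncard ≤ (Nat.card 𝔽 ^ k + 1) +
      (Nat.card 𝔽 ^ (Nat.card 𝔽 ^ (k + 1) * ℓ + 1) + (Nat.card 𝔽 ^ (k + 1) * ℓ + 1) + 1) := by
  classical
  obtain ⟨hnr, hmin⟩ := hex
  have hEf := hfin.ground_finite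
  have hdel : ∀ x ∈ M.E, RepOver 𝔽 (M ＼ {x}) := by
    intro x hx
    refine hmin _ (isMinorOf_iff.2 ⟨∅, {x}, by simp⟩) fun heq => ?_
    rw [delete_eq_self_iff] at heq
    exact heq.notMem_of_mem_left rfl hx
  have hcon : ∀ x ∈ M.E, RepOver 𝔽 (M ／ {x}) := by
    intro x hx
    refine hmin _ (isMinorOf_iff.2 ⟨{x}, ∅, by simp⟩) fun heq => ?_
    rw [contract_eq_self_iff] at heq
    exact heq.notMem_of_mem_left rfl hx
  have hnl : ∀ x ∈ M.E, M.IsNonloop x := by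
    intro x hx
    by_contra h
    exact hnr (repOver_of_loop ((not_isNonloop_iff hx).1 h) (hdel x hx))
  have hsimple : ∀ x ∈ M.E, ∀ y ∈ M.E, x ≠ y → M.Indep {x, y} := by
    intro x hx y hy hxy
    by_contra h
    exact hnr (repOver_of_parallel hxy (hnl x hx) (hnl y hy) h (hdel x hx))
  rcases M.E.eq_empty_or_nonempty with h0 | ⟨e, he⟩
  · rw [h0]; simp
  obtain ⟨W, _, _, φ, hφ⟩ := repOver_iff.1 (hdel e he)
  have hNfin : (M ＼ {e}).Finite := ⟨hEf.subset sdiff_subset⟩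
  obtain ⟨B, hB⟩ := (M ＼ {e}).exists_isBase
  have hBf := hNfin.ground_finite.subset hB.subset_ground
  have hNc : M.E.ncard ≤ (M ＼ {e}).E.ncard + 1 := by
    rw [delete_ground]
    exact (Set.ncard_sdiff_singleton_add_one he hEf).ge
  by_cases hBk : B.ncard ≤ k
  · -- small rank
    obtain ⟨hSf, hSc⟩ := card_span_le (𝔽 := 𝔽) φ B hBf
    have hinj : InjOn φ (M ＼ {e}).E := by
      intro x hx y hy hxy
      by_contra hne
      have h1 := hsimple x hx.1 y hy.1 hne
      have h2 : (M ＼ {e}).Indep {x, y} := by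
        rw [deleteElem_indep_iff]
        refine ⟨h1, ?_⟩
        rintro (h | h)
        · exact hx.2 h.symm
        · exact hy.2 (Eq.symm h)
      have h3 := LinearIndepOn.injOn ((hφ _ h2.subset_ground).1 h2)
      exact hne (h3 (by simp) (by simp) hxy)
    have hle := Set.ncard_le_ncard_of_injOn φ (s := (M ＼ {e}).E)
      (t := (Submodule.span 𝔽 (φ '' B) : Set W))
      (fun x hx => hφ.mem_span hB.subset_ground (by rw [hB.closure_eq]; exact hx)) hinj hSf
    have := hSc.trans (Nat.pow_le_pow_right Nat.card_pos hBk)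
    omega
  · have hcb := corank_bound hNfin (hu.minor ⟨∅, {e}, by simp⟩) hφ hB (by omega)
    obtain ⟨B', hB', hBB'⟩ := hB.indep.of_delete.exists_isBase_superset
    set c := Nat.card 𝔽 ^ (k + 1) * ℓ with hc
    have hcb' : (M.E \ B').ncard ≤ c + 1 := by
      have hsub : M.E \ B' ⊆ insert e ((M ＼ {e}).E \ B) := by
        rintro x ⟨hx, hxB⟩
        by_cases hxe : x = e
        · exact Or.inl hxe
        · exact Or.inr ⟨⟨hx, hxe⟩, fun h => hxB (hBB' h)⟩
      have hf : (insert e ((M ＼ {e}).E \ B)).Finite :=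
        (hNfin.ground_finite.subset sdiff_subset).insert e
      exact (Set.ncard_le_ncard hsub hf).trans ((Set.ncard_insert_le _ _).trans (by omega))
    have hsum := Set.ncard_sdiff_add_ncard_of_subset hB'.subset_ground hEf
    obtain ⟨b, hb⟩ : B'.Nonempty := by
      have := Set.ncard_le_ncard hBB' (hEf.subset hB'.subset_ground)
      exact Set.nonempty_of_ncard_ne_zero (by omega)
    have hbE := hB'.subset_ground hb
    obtain ⟨W', _, _, φ', hφ'⟩ := repOver_iff.1 (hcon b hbE)
    have hBc : (M ／ {b}).IsBase (B' \ {b}) := by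
      rw [(hnl b hbE).indep.contract_isBase_iff]
      exact ⟨by simpa [hb] using hB', disjoint_sdiff_left⟩
    have hground : (M ／ {b}).E \ (B' \ {b}) = M.E \ B' := by
      ext x
      simp only [contract_ground, mem_sdiff, mem_singleton_iff]
      constructor
      · rintro ⟨⟨h1, h2⟩, h3⟩
        exact ⟨h1, fun h => h3 ⟨h, h2⟩⟩
      · rintro ⟨h1, h2⟩
        exact ⟨⟨h1, by rintro rfl; exact h2 hb⟩, fun h => h2 h.1⟩
    have hCfin : (M ／ {b}).Finite := ⟨hEf.subset sdiff_subset⟩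
    have hBb := Set.ncard_sdiff_singleton_add_one hb (hEf.subset hB'.subset_ground)
    have hpow : Nat.card 𝔽 ^ (M.E \ B').ncard ≤ Nat.card 𝔽 ^ (c + 1) :=
      Nat.pow_le_pow_right Nat.card_pos hcb'
    by_contra! hbig
    obtain ⟨x, y, hx, hy, hxy, hcx, hcy⟩ := exists_series hCfin hφ' hBc (by
      rw [hground]; omega)
    have hlift : ∀ z, z ≠ b → z ∈ M.closure (M.E \ {x, y}) →
        z ∈ (M ／ {b}).closure ((M ／ {b}).E \ {x, y}) := by
      intro z hz hzc
      rw [contract_closure_eq]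
      refine ⟨M.closure_subset_closure ?_ hzc, hz⟩
      rintro w ⟨hw1, hw2⟩
      by_cases hwb : w = b
      · exact Or.inr hwb
      · exact Or.inl ⟨⟨hw1, hwb⟩, hw2⟩
    exact hnr (repOver_of_series hxy (hB'.subset_ground hx.1) (hB'.subset_ground hy.1)
      (fun h => hcx (hlift x hx.2 h)) (fun h => hcy (hlift y hy.2 h))
      (hcon x (hB'.subset_ground hx.1)))

lemma uniform_of_small {n : ℕ} (hfin : M.Finite) (hn : M.E.ncard ≤ n) : M.KLUniform (n + 1) 1 := by
  rintro ⟨N, hN, e, -⟩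
  have h1 := Set.ncard_le_ncard (isMinorOf_iff.1 hN).subset hfin.ground_finite
  have h2 : Nat.card N.E = Nat.card (univ : Set (Fin (n + 1 + 1))) := Nat.card_congr e
  rw [Nat.card_univ, Nat.card_fin] at h2
  have h3 : N.E.ncard = n + 1 + 1 := h2
  omega

end Helpers

universe u

/-- the excluded minors for `GF(q)`-representability have bounded size iff
they are all `(k,ℓ)`-uniform for some fixed pair `(k,ℓ)` of positive integers. -/
theorem stmt10 (p c : ℕ) [Fact p.Prime] (hc : c ≠ 0) :
    (∃ n : ℕ, ∀ (α : Type u) (M : Matroid α), M.Finite →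
        ExcludedMinorFor (GaloisField p c) M → M.E.ncard ≤ n) ↔
      (∃ k ℓ : ℕ, 0 < k ∧ 0 < ℓ ∧ ∀ (α : Type u) (M : Matroid α), M.Finite →
        ExcludedMinorFor (GaloisField p c) M → M.KLUniform k ℓ) := by
  constructor
  · rintro ⟨n, hn⟩
    exact ⟨n + 1, 1, by omega, by omega, fun α M hfin hex => uniform_of_small hfin (hn α M hfin hex)⟩
  · rintro ⟨k, ℓ, -, -, h⟩
    exact ⟨_, fun α M hfin hex => excluded_bound hfin hex (h α M hfin hex)⟩

end Matroid
end

section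
/- Every simple, cosimple, binary (2,1)-uniform matroid has rank at most 4, and every simple, cosimple, binary (1,2)-uniform matroid has rank at most 4. -/
open Set

namespace Matroid

variable {α β : Type*}

lemma aux_rank (M : Matroid α) (hfin : M.Finite) {B : Set α} (hB : M.IsBase B) :
    M.rankM = B.ncard := by
  have hg : IsGreatest {n : ℕ | ∃ I, M.Indep I ∧ I ⊆ M.E ∧ I.ncard = n} B.ncard := by
    refine ⟨⟨B, hB.indep, hB.subset_ground, rfl⟩, ?_⟩
    rintro n ⟨I, hI, -, rfl⟩
    obtain ⟨B', hB', hIB⟩ := hI.exists_isBase_superset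
    rw [hB.ncard_eq_ncard_of_isBase hB']
    exact Set.ncard_le_ncard hIB (hfin.ground_finite.subset hB'.subset_ground)
  exact hg.csSup_eq

lemma aux_kl (M : Matroid α) (hfin : M.Finite) {k l : ℕ} {I J B : Set α}
    (hB : M.IsBase B) (hIB : I ⊆ B) (hJ : J ⊆ M.closure I) (hJI : Disjoint J I)
    (hl : l ≤ J.ncard) (hk : k ≤ (B \ I).ncard) : ¬ M.KLUniform k l := by
  classical
  intro h
  apply h
  obtain ⟨K, hK, hKc⟩ := Set.exists_subset_card_eq hk
  obtain ⟨L, hL, hLc⟩ := Set.exists_subset_card_eq hl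
  have hIi : M.Indep I := hB.indep.subset hIB
  have hLE : L ⊆ M.E := hL.trans (hJ.trans (M.closure_subset_ground I))
  have hKE : K ⊆ M.E := hK.trans (sdiff_subset.trans hB.subset_ground)
  have hKf : K.Finite := hfin.ground_finite.subset hKE
  have hLf : L.Finite := hfin.ground_finite.subset hLE
  have hLI : Disjoint L I := hJI.mono_left hL
  have hKI : Disjoint K I := (disjoint_sdiff_left).mono_left hK
  have hnot : ∀ Z : Set α, ∀ x ∈ L, x ∈ Z → ¬ M.Indep (Z ∪ I) := by
    intro Z x hx hxZ hZ
    have h1 : M.Indep (insert x I) :=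
      hZ.subset (insert_subset (Or.inl hxZ) subset_union_right)
    exact (hIi.mem_closure_iff_of_notMem (hLI.notMem_of_mem_left hx)).1 (hJ (hL hx)) |>.not_indep h1
  have hyes : ∀ Z ⊆ K, M.Indep (Z ∪ I) := fun Z hZ =>
    hB.indep.subset (union_subset (hZ.trans (hK.trans sdiff_subset)) hIB)
  have hKL : Disjoint K L := by
    rw [Set.disjoint_left]
    intro x hx hxL
    exact hnot K x hxL hx (hyes K subset_rfl)
  refine ⟨(M.contractS I).deleteS (M.E \ (I ∪ K ∪ L)), ⟨I, _, hIi.subset_ground, sdiff_subset, ?_, rfl⟩, ?_⟩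
  · exact disjoint_sdiff_right.mono_left (subset_union_left.trans subset_union_left)
  have hNE : ((M.contractS I).deleteS (M.E \ (I ∪ K ∪ L))).E = K ∪ L := by
    change (M.E \ I) \ (M.E \ (I ∪ K ∪ L)) = K ∪ L
    ext x
    have := @hLE x
    have := @hKE x
    have := fun h => hLI.notMem_of_mem_left (a := x) h
    have := fun h => hKI.notMem_of_mem_left (a := x) h
    simp only [mem_sdiff, mem_union]
    tauto
  have hNI : ∀ Z ⊆ K ∪ L, ((M.contractS I).deleteS (M.E \ (I ∪ K ∪ L))).Indep Z ↔ Z ⊆ K := by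
    intro Z hZ
    have e1 : ((M.contractS I).deleteS (M.E \ (I ∪ K ∪ L))).Indep Z ↔
        ((M ／ I) ＼ (M.E \ (I ∪ K ∪ L))).Indep Z := Iff.rfl
    have hd : Disjoint Z (M.E \ (I ∪ K ∪ L)) := by
      refine disjoint_sdiff_right.mono_left ?_
      intro x hx
      rcases hZ hx with h | h <;> simp [h]
    rw [e1, delete_indep_iff, hIi.contract_indep_iff]
    constructor
    · rintro ⟨⟨-, h2⟩, -⟩ x hx
      rcases hZ hx with h | h
      · exact h
      · exact (hnot Z x h hx h2).elim
    · intro h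
      exact ⟨⟨hKI.mono_left h, hyes Z h⟩, hd⟩
  generalize ((M.contractS I).deleteS (M.E \ (I ∪ K ∪ L))) = N at hNE hNI
  have c1 : ({i : Fin (k + l) | (i : ℕ) < k}).ncard = k := by
    have : {i : Fin (k + l) | (i : ℕ) < k} = Set.range (Fin.castAdd l : Fin k → Fin (k + l)) := by
      ext i
      constructor
      · intro h; exact ⟨⟨i, h⟩, rfl⟩
      · rintro ⟨j, rfl⟩; simp
    rw [this, ← Set.image_univ, Set.ncard_image_of_injective _ (Fin.castAdd_injective k l)]
    simp
  have c2 : ({i : Fin (k + l) | (i : ℕ) < k}ᶜ).ncard = l := by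
    have := Set.ncard_add_ncard_compl ({i : Fin (k + l) | (i : ℕ) < k})
    simp only [Nat.card_eq_fintype_card, Fintype.card_fin] at this
    omega
  have e1 : Nonempty (K ≃ {i : Fin (k + l) | (i : ℕ) < k}) := by
    have := hKf.to_subtype
    refine Finite.card_eq.1 ?_
    change K.ncard = Set.ncard _
    omega
  have e2 : Nonempty (L ≃ ({i : Fin (k + l) | (i : ℕ) < k}ᶜ : Set _)) := by
    have := hLf.to_subtype
    refine Finite.card_eq.1 ?_
    change L.ncard = Set.ncard _
    omega
  obtain ⟨e1⟩ := e1
  obtain ⟨e2⟩ := e2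
  let e : N.E ≃ (freeLoopy k l).E :=
    (Equiv.setCongr hNE).trans <| (Equiv.Set.union hKL).trans <|
      (Equiv.sumCongr e1 e2).trans <| (Equiv.Set.sumCompl _).trans (Equiv.Set.univ _).symm
  have he : ∀ x : N.E, ((e x : Fin (k+l)) : ℕ) < k ↔ (x : α) ∈ K := by
    rintro ⟨x, hx⟩
    by_cases hxK : x ∈ K
    · have h1 : e ⟨x, hx⟩ = ⟨(e1 ⟨x, hxK⟩ : Fin (k+l)), mem_univ _⟩ := by
        simp only [e, Equiv.trans_apply, Equiv.setCongr_apply]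
        rw [Equiv.Set.union_apply_left _ (by exact hxK)]
        rfl
      have h2 := (e1 ⟨x, hxK⟩).2
      simp only [h1, hxK, iff_true]
      exact h2
    · have hxL : x ∈ L := by
        have := hx
        rw [hNE] at this
        exact this.resolve_left hxK
      have h1 : e ⟨x, hx⟩ = ⟨(e2 ⟨x, hxL⟩ : Fin (k+l)), mem_univ _⟩ := by
        simp only [e, Equiv.trans_apply, Equiv.setCongr_apply]
        rw [Equiv.Set.union_apply_right _ (by exact hxL)]
        rfl
      have h2 := (e2 ⟨x, hxL⟩).2
      simp only [h1, hxK, iff_false]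
      exact h2
  refine ⟨e, fun Z => ?_⟩
  rw [hNI _ (by rw [← hNE]; exact Subtype.coe_image_subset _ _)]
  simp only [freeLoopy]
  rw [uniqueBaseOn_indep_iff (subset_univ _)]
  constructor
  · rintro h _ ⟨_, ⟨z, hz, rfl⟩, rfl⟩
    exact (he z).2 (h ⟨z, hz, rfl⟩)
  · rintro h _ ⟨z, hz, rfl⟩
    exact (he z).1 (h ⟨_, ⟨z, hz, rfl⟩, rfl⟩)

lemma aux_21 (M : Matroid α) (hfin : M.Finite) (h : M.KLUniform 2 1) {B : Set α}
    (hB : M.IsBase B) {X : Set α} (hX : X ⊆ M.E) (hd : ¬ M.Indep X) : B.ncard ≤ X.ncard := by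
  by_contra hlt
  push Not at hlt
  obtain ⟨I, hI⟩ := M.exists_isBasis X hX
  obtain ⟨B', hB', hIB⟩ := hI.indep.exists_isBase_superset
  have hBf := hfin.ground_finite.subset hB'.subset_ground
  have hXf := hfin.ground_finite.subset hX
  have hIX : I ⊂ X := hI.subset.ssubset_of_ne (by rintro rfl; exact hd hI.indep)
  have h1 := Set.ncard_lt_ncard hIX hXf
  have h2 := hB.ncard_eq_ncard_of_isBase hB'
  have h3 := Set.ncard_sdiff_add_ncard_of_subset hIB hBf
  have h4 := Set.ncard_sdiff_add_ncard_of_subset hI.subset hXf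
  exact aux_kl M hfin hB' hIB (J := X \ I) (sdiff_subset.trans hI.subset_closure)
    disjoint_sdiff_left (by omega) (by omega) h

lemma aux_12 (M : Matroid α) (hfin : M.Finite) (h : M.KLUniform 1 2) {B : Set α}
    (hB : M.IsBase B) {X : Set α} (hX : X ⊆ M.E) (hd : ∀ B' ⊆ X, ¬ M.IsBase B') :
    X.ncard ≤ B.ncard := by
  by_contra hlt
  push Not at hlt
  obtain ⟨I, hI⟩ := M.exists_isBasis X hX
  obtain ⟨B', hB', hIB⟩ := hI.indep.exists_isBase_superset
  have hBf := hfin.ground_finite.subset hB'.subset_ground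
  have hXf := hfin.ground_finite.subset hX
  have hIX : I ⊂ B' := hIB.ssubset_of_ne (by rintro rfl; exact hd _ hI.subset hB')
  have h1 := Set.ncard_lt_ncard hIX hBf
  have h2 := hB.ncard_eq_ncard_of_isBase hB'
  have h3 := Set.ncard_sdiff_add_ncard_of_subset hIB hBf
  have h4 := Set.ncard_sdiff_add_ncard_of_subset hI.subset hXf
  exact aux_kl M hfin hB' hIB (J := X \ I) (sdiff_subset.trans hI.subset_closure)
    disjoint_sdiff_left (by omega) (by omega) h

lemma aux_simple (M : Matroid α) (hs : M.SimpleM) {X : Set α} (hX : X ⊆ M.E)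
    (hf : X.Finite) (h2 : X.ncard ≤ 2) : M.Indep X := by
  by_contra hd
  have hd' : M.Dep X := ⟨hd, hX⟩
  obtain ⟨C, hCX, hC⟩ := hd'.exists_isCircuit_subset
  have h3 := hs C ⟨hC.subset_ground, hC.not_indep, fun D hD => hC.ssubset_indep hD⟩
  have h4 := Set.ncard_le_ncard hCX hf
  omega

section rep

variable {W : Type} [AddCommGroup W] [Module (ZMod 2) W] {φ : α → W}

lemma aux_span (M : Matroid α)
    (hφ : ∀ I ⊆ M.E, (M.Indep I ↔ Set.InjOn φ I ∧ LinearIndependent (ZMod 2) (fun x : I => φ x)))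
    {B : Set α} (hB : M.IsBase B) {e : α} (he : e ∈ M.E) :
    φ e ∈ Submodule.span (ZMod 2) (φ '' B) := by
  by_contra hn
  have heB : e ∉ B := fun h => hn (Submodule.subset_span ⟨e, h, rfl⟩)
  have hd := hB.insert_dep ⟨he, heB⟩
  obtain ⟨hinj, hli⟩ := (hφ B hB.subset_ground).1 hB.indep
  apply hd.not_indep
  rw [hφ _ hd.subset_ground]
  constructor
  · rw [Set.injOn_insert heB]
    exact ⟨hinj, fun h => hn (Submodule.subset_span h)⟩
  · have : LinearIndepOn (ZMod 2) φ (insert e B) := LinearIndepOn.insert hli hn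
    exact this

lemma aux_nonspan (M : Matroid α)
    (hφ : ∀ I ⊆ M.E, (M.Indep I ↔ Set.InjOn φ I ∧ LinearIndependent (ZMod 2) (fun x : I => φ x)))
    (f : W →ₗ[ZMod 2] ZMod 2) {X : Set α} (hX : ∀ x ∈ X, f (φ x) = 0)
    {e : α} (he : e ∈ M.E) (hfe : f (φ e) ≠ 0) : ∀ B ⊆ X, ¬ M.IsBase B := by
  intro B hBX hB
  apply hfe
  have h1 : Submodule.span (ZMod 2) (φ '' B) ≤ LinearMap.ker f := by
    rw [Submodule.span_le]
    rintro _ ⟨x, hx, rfl⟩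
    exact hX x (hBX hx)
  exact h1 (aux_span M hφ hB he)

lemma aux_dep (M : Matroid α)
    (hφ : ∀ I ⊆ M.E, (M.Indep I ↔ Set.InjOn φ I ∧ LinearIndependent (ZMod 2) (fun x : I => φ x)))
    (X : Finset α) (hX : (X : Set α) ⊆ M.E) (hne : X.Nonempty) (hsum : ∑ x ∈ X, φ x = 0) :
    ¬ M.Indep (X : Set α) := by
  intro h
  have h1 : LinearIndepOn (ZMod 2) φ (X : Set α) := ((hφ _ hX).1 h).2
  rw [linearIndepOn_finset_iff] at h1
  obtain ⟨x, hx⟩ := hne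
  exact one_ne_zero (h1 (fun _ => 1) (by simpa using hsum) x hx)

lemma aux_coord (M : Matroid α)
    (hφ : ∀ I ⊆ M.E, (M.Indep I ↔ Set.InjOn φ I ∧ LinearIndependent (ZMod 2) (fun x : I => φ x)))
    (B : Finset α) (hB : M.IsBase (B : Set α)) :
    ∃ c : α → W →ₗ[ZMod 2] ZMod 2, (∀ b ∈ B, ∀ b' ∈ B, c b (φ b') = 1 ↔ b = b') ∧
      ∀ e ∈ M.E, φ e = ∑ b ∈ B, c b (φ e) • φ b := by
  classical
  have hli := ((hφ _ hB.subset_ground).1 hB.indep).2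
  have hex : ∀ b : α, ∃ c : W →ₗ[ZMod 2] ZMod 2, b ∈ B →
      ∀ b' ∈ B, c (φ b') = if b = b' then 1 else 0 := by
    intro b
    by_cases hb : b ∈ B
    · let bs := Module.Basis.span hli
      obtain ⟨c, hc⟩ := LinearMap.exists_extend (bs.coord ⟨b, hb⟩)
      refine ⟨c, fun _ b' hb' => ?_⟩
      have h1 : φ b' = ((bs ⟨b', hb'⟩ : _) : W) := by
        rw [Module.Basis.span_apply]
      have h2 := LinearMap.congr_fun hc (bs ⟨b', hb'⟩)
      rw [h1]
      simp only [LinearMap.comp_apply, Submodule.subtype_apply] at h2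
      rw [h2, Module.Basis.coord_apply, Module.Basis.repr_self, Finsupp.single_apply]
      simp [eq_comm]
    · exact ⟨0, fun h => (hb h).elim⟩
  choose c hc using hex
  refine ⟨c, fun b hb b' hb' => ?_, fun e he => ?_⟩
  · rw [hc b hb b' hb']
    split_ifs with h <;> simp [h]
  · have h1 := aux_span M hφ hB he
    have h2 : ∀ w ∈ Submodule.span (ZMod 2) (φ '' (B : Set α)), w = ∑ b ∈ B, c b w • φ b := by
      intro w hw
      induction hw using Submodule.span_induction with
      | mem x hx =>
        obtain ⟨b, hb, rfl⟩ := hx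
        have hb : b ∈ B := hb
        rw [Finset.sum_eq_single b]
        · rw [hc b hb b hb]; simp
        · intro b' hb' hne
          rw [hc b' hb' b hb]; simp [hne]
        · intro h; exact (h hb).elim
      | zero => simp
      | add x y _ _ hx hy =>
        simp only [map_add, add_smul, Finset.sum_add_distrib]
        rw [← hx, ← hy]
      | smul a x _ hx =>
        simp only [map_smul, smul_eq_mul, mul_smul]
        rw [← Finset.smul_sum, ← hx]
    exact h2 _ h1

end rep

lemma zmod2_eq_ite (x : ZMod 2) : x = if x = 1 then 1 else 0 := by
  revert x; decide

lemma zmod2_add_ite (x y : ZMod 2) : x + y = if x ≠ y then 1 else 0 := by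
  revert x y; decide

lemma zmod2_ne (x y z : ZMod 2) (h : x ≠ y) : x ≠ z ∨ y ≠ z := by
  revert x y z; decide

lemma zmod2_add_eq_zero (x y : ZMod 2) : x + y = 0 ↔ x = y := by
  revert x y; decide

lemma zmod2_ne_one (x : ZMod 2) : x ≠ 1 ↔ x = 0 := by
  revert x; decide

lemma aux_vec_self {W : Type} [AddCommGroup W] [Module (ZMod 2) W] (w : W) : w + w = 0 := by
  rw [← two_smul (ZMod 2) w, show (2 : ZMod 2) = 0 from rfl, zero_smul]

/-- a simple cosimple binary `(2,1)`-uniform matroid has rank at most `4`,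
and a simple cosimple binary `(1,2)`-uniform matroid has rank at most `4`. -/
theorem stmt13 {α : Type*} (M : Matroid α) (hfin : M.Finite)
    (hs : M.SimpleM) (hcs : M✶.SimpleM) (hbin : Matroid.RepOver (ZMod 2) M) :
    (M.KLUniform 2 1 → M.rankM ≤ 4) ∧ (M.KLUniform 1 2 → M.rankM ≤ 4) := by
  classical
  obtain ⟨W, _, _, φ, hφ⟩ := hbin
  obtain ⟨B0, hB0⟩ := M.exists_isBase
  have hEf := hfin.ground_finite
  obtain ⟨E, hE⟩ := hEf.exists_finset_coe
  obtain ⟨B, rfl⟩ := (hEf.subset hB0.subset_ground).exists_finset_coe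
  have hBE : B ⊆ E := by
    have := hB0.subset_ground
    rw [← hE] at this
    exact_mod_cast this
  obtain ⟨c, hc1, hc2⟩ := aux_coord M hφ B hB0
  rw [aux_rank M hfin hB0, Set.ncard_coe_finset]
  have hmemE : ∀ x, x ∈ M.E ↔ x ∈ E := fun x => by rw [← hE]; simp
  have hcard : (E \ B).card + B.card = E.card := Finset.card_sdiff_add_card_eq_card hBE
  have hpair : ∀ b ∈ B, ∀ b' ∈ B, ∃ B' : Set α, M.IsBase B' ∧ b ∉ B' ∧ b' ∉ B' := by
    intro b hb b' hb'
    have h1 : M✶.Indep {b, b'} := by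
      refine aux_simple M✶ hcs ?_ (Set.toFinite _) ((Set.ncard_insert_le b {b'}).trans (by simp))
      rw [dual_ground]
      exact Set.pair_subset ((hmemE _).2 (hBE hb)) ((hmemE _).2 (hBE hb'))
    rw [dual_indep_iff_exists'] at h1
    obtain ⟨-, B', hB', hd⟩ := h1
    exact ⟨B', hB', Set.disjoint_left.1 hd (by simp), Set.disjoint_left.1 hd (by simp)⟩
  constructor
  · intro hU
    by_contra hr
    push Not at hr
    have hlow : ∀ X : Finset α, X ⊆ E → X.Nonempty → ∑ x ∈ X, φ x = 0 → B.card ≤ X.card := by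
      intro X hX hne hsum
      have hX' : (X : Set α) ⊆ M.E := by rw [← hE]; exact_mod_cast hX
      have := aux_21 M hfin hU hB0 hX' (aux_dep M hφ X hX' hne hsum)
      simpa only [Set.ncard_coe_finset] using this
    have hw : ∀ e ∈ E \ B, (B.filter (fun b => ¬ c b (φ e) = 1)).card ≤ 1 := by
      intro e he
      obtain ⟨heE, heB⟩ := Finset.mem_sdiff.1 he
      have h1 := hlow (insert e (B.filter (fun b => c b (φ e) = 1)))
        (Finset.insert_subset heE ((Finset.filter_subset _ _).trans hBE)) (by simp) (by
          rw [Finset.sum_insert (by simp [heB]), Finset.sum_filter]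
          have h2 := hc2 e ((hmemE e).2 heE)
          have h3 : ∑ b ∈ B, c b (φ e) • φ b = ∑ b ∈ B, (if c b (φ e) = 1 then φ b else 0) := by
            refine Finset.sum_congr rfl fun b _ => ?_
            conv_lhs => rw [zmod2_eq_ite (c b (φ e))]
            split_ifs <;> simp
          rw [← h3, ← h2]
          exact aux_vec_self _)
      rw [Finset.card_insert_of_notMem (by simp [heB])] at h1
      have h4 := Finset.card_filter_add_card_filter_not (s := B) (fun b => c b (φ e) = 1)
      omega
    have hm : (E \ B).card ≤ 1 := by
      rw [Finset.card_le_one]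
      intro e he f hf
      by_contra hne
      have he1 := hw e he
      have hf1 := hw f hf
      obtain ⟨heE, heB⟩ := Finset.mem_sdiff.1 he
      obtain ⟨hfE, hfB⟩ := Finset.mem_sdiff.1 hf
      have h1 := hlow (insert e (insert f (B.filter (fun b => c b (φ e) ≠ c b (φ f)))))
        (Finset.insert_subset heE (Finset.insert_subset hfE
          ((Finset.filter_subset _ _).trans hBE))) (by simp) (by
          rw [Finset.sum_insert (by simp [heB, hne]), Finset.sum_insert (by simp [hfB]),
            Finset.sum_filter]
          have h2 := hc2 e ((hmemE e).2 heE)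
          have h2' := hc2 f ((hmemE f).2 hfE)
          have h3 : ∑ b ∈ B, c b (φ e) • φ b + ∑ b ∈ B, c b (φ f) • φ b
              = ∑ b ∈ B, (if c b (φ e) ≠ c b (φ f) then φ b else 0) := by
            rw [← Finset.sum_add_distrib]
            refine Finset.sum_congr rfl fun b _ => ?_
            rw [← add_smul, zmod2_add_ite]
            split_ifs <;> simp
          rw [← h3, ← h2, ← h2', ← add_assoc]
          exact aux_vec_self _)
      have h5 := Finset.card_insert_le e (insert f (B.filter (fun b => c b (φ e) ≠ c b (φ f))))
      have h6 := Finset.card_insert_le f (B.filter (fun b => c b (φ e) ≠ c b (φ f)))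
      have h7 : B.filter (fun b => c b (φ e) ≠ c b (φ f)) ⊆
          B.filter (fun b => ¬ c b (φ e) = 1) ∪ B.filter (fun b => ¬ c b (φ f) = 1) := by
        intro b hb
        simp only [Finset.mem_filter, Finset.mem_union] at hb ⊢
        rcases zmod2_ne _ _ 1 hb.2 with h | h
        · exact Or.inl ⟨hb.1, h⟩
        · exact Or.inr ⟨hb.1, h⟩
      have h8 := (Finset.card_le_card h7).trans (Finset.card_union_le _ _)
      omega
    obtain ⟨b, hb, b', hb', hne⟩ := Finset.one_lt_card.1 (show 1 < B.card by omega)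
    obtain ⟨B', hB', h1, h2⟩ := hpair b hb b' hb'
    obtain ⟨B', rfl⟩ := (hEf.subset hB'.subset_ground).exists_finset_coe
    have h3 := hB'.ncard_eq_ncard_of_isBase hB0
    simp only [Set.ncard_coe_finset] at h3
    have h4 : insert b (insert b' B') ⊆ E :=
      Finset.insert_subset (hBE hb) (Finset.insert_subset (hBE hb') (by
        have := hB'.subset_ground
        rw [← hE] at this
        exact_mod_cast this))
    have h5 := Finset.card_le_card h4
    rw [Finset.card_insert_of_notMem (by
      simp only [Finset.mem_insert, not_or]; exact ⟨hne, h1⟩),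
      Finset.card_insert_of_notMem (by exact h2)] at h5
    omega
  · intro hU
    by_contra hr
    push Not at hr
    have hup : ∀ f : W →ₗ[ZMod 2] ZMod 2, (∃ e ∈ E, f (φ e) ≠ 0) →
        (E.filter (fun x => f (φ x) = 0)).card ≤ B.card := by
      rintro f ⟨e, he, hfe⟩
      have := aux_12 M hfin hU hB0 (X := (E.filter (fun x => f (φ x) = 0) : Finset α))
        (by rw [← hE]; exact_mod_cast Finset.filter_subset _ _)
        (aux_nonspan M hφ f (by simp) ((hmemE e).2 he) hfe)
      simpa only [Set.ncard_coe_finset] using this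
    have hc0 : ∀ b ∈ B, ∀ x ∈ B, x ≠ b → c b (φ x) = 0 := by
      intro b hb x hx hne
      rw [← zmod2_ne_one]
      exact fun h => hne ((hc1 b hb x hx).1 h).symm
    have hcb : ∀ b ∈ B, c b (φ b) = 1 := fun b hb => (hc1 b hb b hb).2 rfl
    let Z : α → Finset α := fun b => (E \ B).filter (fun e => c b (φ e) = 0)
    have hZ : ∀ b ∈ B, (Z b).card ≤ 1 := by
      intro b hb
      have h1 := hup (c b) ⟨b, hBE hb, by rw [hcb b hb]; exact one_ne_zero⟩
      have h2 : (B.erase b) ∪ Z b ⊆ E.filter (fun x => c b (φ x) = 0) := by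
        intro x hx
        simp only [Z, Finset.mem_union, Finset.mem_erase, Finset.mem_filter, Finset.mem_sdiff] at hx ⊢
        rcases hx with ⟨hne, hx⟩ | ⟨⟨hx, -⟩, h⟩
        · exact ⟨hBE hx, hc0 b hb x hx hne⟩
        · exact ⟨hx, h⟩
      have h3 : Disjoint (B.erase b) (Z b) := by
        rw [Finset.disjoint_left]
        intro x hx hx'
        simp only [Z, Finset.mem_filter, Finset.mem_sdiff] at hx'
        exact hx'.1.2 (Finset.mem_of_mem_erase hx)
      have h4 := Finset.card_le_card h2
      rw [Finset.card_union_of_disjoint h3, Finset.card_erase_of_mem hb] at h4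
      omega
    have hZZ : ∀ b ∈ B, ∀ b' ∈ B, b ≠ b' → (E \ B).card ≤ 2 + (Z b ∪ Z b').card := by
      intro b hb b' hb' hne
      have h1 := hup (c b + c b') ⟨b, hBE hb, by
        rw [LinearMap.add_apply, hcb b hb, hc0 b' hb' b hb hne, add_zero]; exact one_ne_zero⟩
      have h2 : ((B.erase b).erase b') ∪ ((E \ B) \ (Z b ∪ Z b')) ⊆
          E.filter (fun x => (c b + c b') (φ x) = 0) := by
        intro x hx
        simp only [Z, Finset.mem_union, Finset.mem_erase, Finset.mem_filter, Finset.mem_sdiff,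
          LinearMap.add_apply] at hx ⊢
        rcases hx with ⟨hne', hne, hx⟩ | ⟨⟨hx, hxB⟩, h⟩
        · refine ⟨hBE hx, ?_⟩
          rw [hc0 b hb x hx hne, hc0 b' hb' x hx hne', add_zero]
        · refine ⟨hx, ?_⟩
          rw [zmod2_add_eq_zero]
          by_contra hh
          rcases zmod2_ne _ _ 1 hh with h' | h'
          · exact h (Or.inl ⟨⟨hx, hxB⟩, (zmod2_ne_one _).1 h'⟩)
          · exact h (Or.inr ⟨⟨hx, hxB⟩, (zmod2_ne_one _).1 h'⟩)
      have h3 : Disjoint ((B.erase b).erase b') ((E \ B) \ (Z b ∪ Z b')) := by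
        rw [Finset.disjoint_left]
        intro x hx hx'
        simp only [Finset.mem_sdiff] at hx'
        exact hx'.1.2 (Finset.mem_of_mem_erase (Finset.mem_of_mem_erase hx))
      have h4 := Finset.card_le_card h2
      rw [Finset.card_union_of_disjoint h3,
        Finset.card_erase_of_mem (Finset.mem_erase.2 ⟨hne.symm, hb'⟩),
        Finset.card_erase_of_mem hb] at h4
      have h5 := Finset.le_card_sdiff (Z b ∪ Z b') (E \ B)
      omega
    have hinj : ∀ b ∈ B, ∀ b' ∈ B, Z b = Z b' → b = b' := by
      intro b hb b' hb' hZe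
      by_contra hne
      obtain ⟨B', hB', h1, h2⟩ := hpair b hb b' hb'
      refine aux_nonspan M hφ (c b + c b') (X := B') ?_ ((hmemE b).2 (hBE hb)) (by
        rw [LinearMap.add_apply, hcb b hb, hc0 b' hb' b hb hne, add_zero]; exact one_ne_zero)
        B' subset_rfl hB'
      intro x hx
      have hxE := (hmemE x).1 (hB'.subset_ground hx)
      rw [LinearMap.add_apply]
      by_cases hxB : x ∈ B
      · rw [hc0 b hb x hxB (by rintro rfl; exact h1 hx),
          hc0 b' hb' x hxB (by rintro rfl; exact h2 hx), add_zero]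
      · have h3 : x ∈ Z b ↔ x ∈ Z b' := by rw [hZe]
        simp only [Z, Finset.mem_filter, Finset.mem_sdiff, hxE, hxB, not_false_eq_true,
          and_self, true_and] at h3
        rw [zmod2_add_eq_zero]
        by_contra hh
        rcases zmod2_ne _ _ 1 hh with h' | h'
        · have h'' := (zmod2_ne_one _).1 h'
          exact hh (by rw [h'', h3.1 h''])
        · have h'' := (zmod2_ne_one _).1 h'
          exact hh (by rw [h'', h3.2 h''])
    have hcount : (B.filter (fun b => (Z b).Nonempty)).card ≤ (E \ B).card := by
      have hex : ∀ b : α, ∃ e, (Z b).Nonempty → e ∈ Z b := by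
        intro b
        by_cases h : (Z b).Nonempty
        · exact ⟨h.choose, fun _ => h.choose_spec⟩
        · exact ⟨b, fun h' => (h h').elim⟩
      choose g hg using hex
      refine Finset.card_le_card_of_injOn g ?_ ?_
      · intro b hb
        have hb := Finset.mem_filter.1 (Finset.mem_coe.1 hb)
        exact Finset.mem_coe.2 (Finset.mem_filter.1 (hg b hb.2)).1
      · intro b hb b' hb' hgg
        have hb := Finset.mem_filter.1 (Finset.mem_coe.1 hb)
        have hb' := Finset.mem_filter.1 (Finset.mem_coe.1 hb')
        apply hinj b hb.1 b' hb'.1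
        have h1 := hg b hb.2
        have h2 := hg b' hb'.2
        rw [← hgg] at h2
        ext x
        constructor
        · intro hx
          rwa [Finset.card_le_one.1 (hZ b hb.1) x hx _ h1]
        · intro hx
          rwa [Finset.card_le_one.1 (hZ b' hb'.1) x hx _ h2]
    have hempty : (B.filter (fun b => ¬ (Z b).Nonempty)).card ≤ 1 := by
      rw [Finset.card_le_one]
      intro b hb b' hb'
      simp only [Finset.mem_filter, Finset.not_nonempty_iff_eq_empty] at hb hb'
      exact hinj b hb.1 b' hb'.1 (by rw [hb.2, hb'.2])
    have hsplit := Finset.card_filter_add_card_filter_not (s := B) (fun b => (Z b).Nonempty)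
    by_cases hz : ∃ b ∈ B, Z b = ∅
    · obtain ⟨b, hb, hbz⟩ := hz
      obtain ⟨b', hb', hne⟩ := Finset.exists_mem_ne (show 1 < B.card by omega) b
      have h1 := hZZ b hb b' hb' hne.symm
      rw [hbz, Finset.empty_union] at h1
      have h2 := hZ b' hb'
      omega
    · have h0 : (B.filter (fun b => ¬ (Z b).Nonempty)) = ∅ := by
        rw [Finset.filter_eq_empty_iff]
        intro b hb hn
        exact hz ⟨b, hb, Finset.not_nonempty_iff_eq_empty.1 hn⟩
      rw [h0, Finset.card_empty] at hsplit
      obtain ⟨b, hb, b', hb', hne⟩ := Finset.one_lt_card.1 (show 1 < B.card by omega)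
      have h1 := hZZ b hb b' hb' hne
      have h2 := Finset.card_union_le (Z b) (Z b')
      have h3 := hZ b hb
      have h4 := hZ b' hb'
      omega

end Matroid
end
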